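/- arXiv:1404.6920 — 3 statements merged into one kernel-verified Lean document; each statement's English description precedes it below -/
import Mathlib

section
/- Let a ∈ (0, c/r_min] and let (x_0, d_0) ∈ E × [a·r_min, a] be a pair with P^s(E) = h(x_0, d_0). Then either d_0 = a, or the boundary sphere ∂B(x_0, d_0) meets E, i.e. ∂B(x_0,d_0) ∩ E ≠ ∅. -/
open Metric Set MeasureTheory Filter Topology
open scoped ENNReal NNReal

noncomputable section

/-- `P^s_δ(A)`: the supremum of `∑ᵢ |Bᵢ|^s` over all `δ`-packings of `A`, i.e. countable
collections of pairwise disjoint closed balls centered at points of `A` with diameters `≤ δ`.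
(Finite packings are represented by padding with empty balls of negative radius, which
contribute `0` to the sum.) -/
def packPre {X : Type*} [PseudoMetricSpace X] (s δ : ℝ) (A : Set X) : ℝ≥0∞ :=
  ⨆ (cen : ℕ → X) (rad : ℕ → ℝ) (_ : ∀ i, cen i ∈ A)
    (_ : ∀ i, Metric.diam (Metric.closedBall (cen i) (rad i)) ≤ δ)
    (_ : Pairwise fun i j =>
      Disjoint (Metric.closedBall (cen i) (rad i)) (Metric.closedBall (cen j) (rad j))),
    ∑' i, ENNReal.ofReal (Metric.diam (Metric.closedBall (cen i) (rad i)) ^ s)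

/-- The packing premeasure `P₀^s(A) = lim_{δ→0} P^s_δ(A)`; since `δ ↦ P^s_δ(A)` is
nondecreasing, the limit is the infimum over `δ > 0`. -/
def packPre0 {X : Type*} [PseudoMetricSpace X] (s : ℝ) (A : Set X) : ℝ≥0∞ :=
  ⨅ (δ : ℝ) (_ : 0 < δ), packPre s δ A

/-- The packing measure `P^s(A) = inf { ∑ᵢ P₀^s(Uᵢ) : A ⊆ ⋃ᵢ Uᵢ }`. -/
def packM {X : Type*} [PseudoMetricSpace X] (s : ℝ) (A : Set X) : ℝ≥0∞ :=
  ⨅ (U : ℕ → Set X) (_ : A ⊆ ⋃ i, U i), ∑' i, packPre0 s (U i)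

/-- The density function `h(x,d) = (2d)^s / μ(B(x,d))` (closed ball). -/
def densityh {X : Type*} [PseudoMetricSpace X] [MeasurableSpace X]
    (μ : MeasureTheory.Measure X) (s : ℝ) (x : X) (d : ℝ) : ℝ≥0∞ :=
  ENNReal.ofReal ((2 * d) ^ s) / μ (Metric.closedBall x d)

/-- The discrete density function `h_k(x,d) = (2d)^s / μ_k(B'(x,d))` (open ball). -/
def densityhk {X : Type*} [PseudoMetricSpace X] [MeasurableSpace X]
    (μ : MeasureTheory.Measure X) (s : ℝ) (x : X) (d : ℝ) : ℝ≥0∞ :=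
  ENNReal.ofReal ((2 * d) ^ s) / μ (Metric.ball x d)

/-- `fWord f σ k = f_{σ 0} ∘ ⋯ ∘ f_{σ (k-1)}`: the composition of the maps along the
first `k` letters of the code `σ` (so `fWord f σ k '' E` is the cylinder set `E_{σ(k)}`). -/
def fWord {X : Type*} {N : ℕ} (f : Fin N → X → X) (σ : ℕ → Fin N) : ℕ → X → X
  | 0 => id
  | (k+1) => fWord f σ k ∘ f (σ k)

/-- `rWord rr σ k = r_{σ 0} ⋯ r_{σ (k-1)}`: the contraction ratio of `fWord f σ k`. -/
def rWord {N : ℕ} (rr : Fin N → ℝ) (σ : ℕ → Fin N) (k : ℕ) : ℝ :=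
  ∏ j ∈ Finset.range k, rr (σ j)

/-- The algorithm's point sets: `algA f 1` is the set of fixed points of the maps `fᵢ`,
and `algA f (k+1) = ⋃ i, fᵢ(algA f k)`; `algA f 0` is unused (empty). -/
def algA {X : Type*} {N : ℕ} (f : Fin N → X → X) : ℕ → Set X
  | 0 => ∅
  | 1 => {x | ∃ i, f i x = x}
  | (k+2) => ⋃ i, f i '' algA f (k+1)

/-- Composition of the maps `fᵢ` along a finite word `w`. -/
def wordComp {X : Type*} {N : ℕ} (f : Fin N → X → X) : ∀ k, (Fin k → Fin N) → X → X
  | 0, _ => id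
  | (k+1), w => f (w 0) ∘ wordComp f k (w ∘ Fin.succ)

/-- The discrete measures `μ_k = ∑_{x ∈ A_k} r_{i_k(x)}^s · δ_x`: the sum runs over all
words `w` of length `k`, with weight `r_w^s` and Dirac mass at the point of `A_k` with
address `w`, namely `f_w(fix(last letter of w))`; `algMu … 0` is unused (zero measure). -/
def algMu {X : Type*} [MeasurableSpace X] {N : ℕ} (f : Fin N → X → X)
    (rr : Fin N → ℝ) (fix : Fin N → X) (s : ℝ) : ℕ → MeasureTheory.Measure X
  | 0 => 0
  | (k+1) => ∑ w : Fin (k+1) → Fin N,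
      ENNReal.ofReal ((∏ j, rr (w j)) ^ s) •
        MeasureTheory.Measure.dirac (wordComp f (k+1) w (fix (w (Fin.last k))))

/-- The algorithm's admissible set of radii
`D_k = {dist(x,y) : x, y ∈ A_k} ∩ [c̃, c̃/r_min]`. -/
def algD {X : Type*} [PseudoMetricSpace X] {N : ℕ} (f : Fin N → X → X)
    (ct rmin : ℝ) (k : ℕ) : Set ℝ :=
  {d | (∃ x ∈ algA f k, ∃ y ∈ algA f k, d = dist x y) ∧ ct ≤ d ∧ d ≤ ct / rmin}

end

section PackAux

variable {n N : ℕ}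

local notation "𝔼" => EuclideanSpace ℝ (Fin n)

/-- the ENNReal weights add up to one -/
lemma aux_weights {rr : Fin N → ℝ} (hr : ∀ i, 0 < rr i ∧ rr i < 1) {s : ℝ}
    (hsum : ∑ i, rr i ^ s = 1) : ∑ i, ENNReal.ofReal (rr i ^ s) = 1 := by
  rw [← ENNReal.ofReal_sum_of_nonneg (fun i _ => Real.rpow_nonneg (hr i).1.le s), hsum]
  simp

lemma aux_continuous {f : Fin N → EuclideanSpace ℝ (Fin n) → EuclideanSpace ℝ (Fin n)}
    {rr : Fin N → ℝ} (hr : ∀ i, 0 < rr i ∧ rr i < 1)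
    (hsim : ∀ i x y, dist (f i x) (f i y) = rr i * dist x y) (i : Fin N) :
    Continuous (f i) := by
  have : LipschitzWith ⟨rr i, (hr i).1.le⟩ (f i) :=
    LipschitzWith.of_dist_le_mul (fun x y => (hsim i x y).le)
  exact this.continuous

/-- The self-similar measure lives on the attractor. -/
lemma aux_support {f : Fin N → EuclideanSpace ℝ (Fin n) → EuclideanSpace ℝ (Fin n)}
    {rr : Fin N → ℝ} (hr : ∀ i, 0 < rr i ∧ rr i < 1)
    (hsim : ∀ i x y, dist (f i x) (f i y) = rr i * dist x y)
    {E : Set (EuclideanSpace ℝ (Fin n))} (hEne : E.Nonempty) (hEcp : IsCompact E)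
    (hEinv : E = ⋃ i, f i '' E) {s : ℝ} (hsum : ∑ i, rr i ^ s = 1)
    {μ : MeasureTheory.Measure (EuclideanSpace ℝ (Fin n))} (hμ : IsProbabilityMeasure μ)
    (hμss : ∀ A : Set (EuclideanSpace ℝ (Fin n)), MeasurableSet A →
      μ A = ∑ i, ENNReal.ofReal (rr i ^ s) * μ (f i ⁻¹' A))
    {R : ℝ} (hR0 : 0 < R) (hR1 : R < 1) (hR : ∀ i, rr i ≤ R) : μ Eᶜ = 0 := by
  have hw := aux_weights hr hsum
  have hf : ∀ i x, infDist (f i x) E ≤ R * infDist x E := by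
    intro i x
    obtain ⟨y, hy, hxy⟩ := hEcp.exists_infDist_eq_dist hEne x
    have hfy : f i y ∈ E := by
      rw [hEinv]; exact mem_iUnion.2 ⟨i, y, hy, rfl⟩
    calc infDist (f i x) E ≤ dist (f i x) (f i y) := infDist_le_dist_of_mem hfy
      _ = rr i * dist x y := hsim i x y
      _ ≤ R * dist x y := by gcongr; exact hR i
      _ = _ := by rw [hxy]
  let D : ℝ → Set 𝔼 := fun t => {x | t < infDist x E}
  have hDm : ∀ t, MeasurableSet (D t) := fun t =>
    (isOpen_lt continuous_const (continuous_infDist_pt E)).measurableSet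
  have hstep : ∀ t, μ (D t) ≤ μ (D (t / R)) := by
    intro t
    rw [hμss _ (hDm t)]
    calc ∑ i, ENNReal.ofReal (rr i ^ s) * μ (f i ⁻¹' D t)
        ≤ ∑ i, ENNReal.ofReal (rr i ^ s) * μ (D (t / R)) := by
          gcongr with i
          intro x hx
          have h1 : t < infDist (f i x) E := hx
          show t / R < infDist x E
          rw [div_lt_iff₀ hR0]
          linarith [hf i x]
      _ = _ := by rw [← Finset.sum_mul, hw, one_mul]
  have hiter : ∀ t (k : ℕ), μ (D t) ≤ μ (D (t / R ^ k)) := by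
    intro t k
    induction k with
    | zero => simp
    | succ k ih =>
      refine ih.trans ((hstep _).trans (le_of_eq ?_))
      rw [div_div, pow_succ]
  have hzero : ∀ t, 0 < t → μ (D t) = 0 := by
    intro t ht
    have hanti : Antitone (fun k : ℕ => D (t / R ^ k)) := by
      intro k l hkl x hx
      have h1 : t / R ^ l < infDist x E := hx
      show t / R ^ k < infDist x E
      refine lt_of_le_of_lt ?_ h1
      apply div_le_div_of_nonneg_left ht.le (by positivity)
      exact pow_le_pow_of_le_one hR0.le hR1.le hkl
    have hlim := tendsto_measure_iInter_atTop (μ := μ) (s := fun k : ℕ => D (t / R ^ k))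
      (fun k => (hDm _).nullMeasurableSet) hanti ⟨0, measure_ne_top _ _⟩
    have hempty : ⋂ k : ℕ, D (t / R ^ k) = ∅ := by
      rw [eq_empty_iff_forall_notMem]
      intro x hx
      rw [mem_iInter] at hx
      obtain ⟨k, hk⟩ := exists_pow_lt_of_lt_one (show 0 < t / (infDist x E + 1) by
        have := infDist_nonneg (x := x) (s := E); positivity) hR1
      have h1 : t / R ^ k < infDist x E := hx k
      have h2 := infDist_nonneg (x := x) (s := E)
      have h3 : 0 < R ^ k := by positivity
      rw [lt_div_iff₀ (by linarith)] at hk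
      rw [div_lt_iff₀ h3] at h1
      nlinarith
    rw [hempty, measure_empty] at hlim
    exact le_antisymm (ge_of_tendsto' hlim (fun k => hiter t k)) (zero_le)
  have hcov : Eᶜ ⊆ ⋃ k : ℕ, D (1 / ((k : ℝ) + 1)) := by
    intro x hx
    have h1 : 0 < infDist x E := (hEcp.isClosed.notMem_iff_infDist_pos hEne).1 hx
    obtain ⟨k, hk⟩ := exists_nat_one_div_lt h1
    exact mem_iUnion.2 ⟨k, hk⟩
  refine measure_mono_null hcov (measure_iUnion_null fun k => hzero _ (by positivity))

/-- scaling of small balls -/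
lemma aux_ball {f : Fin N → EuclideanSpace ℝ (Fin n) → EuclideanSpace ℝ (Fin n)}
    {rr : Fin N → ℝ} (hr : ∀ i, 0 < rr i ∧ rr i < 1)
    (hsim : ∀ i x y, dist (f i x) (f i y) = rr i * dist x y)
    {E : Set (EuclideanSpace ℝ (Fin n))} {c s : ℝ}
    (hcdist : ∀ i j, i ≠ j → ∀ u ∈ E, ∀ v ∈ E, c ≤ dist (f i u) (f j v))
    {μ : MeasureTheory.Measure (EuclideanSpace ℝ (Fin n))}
    (hμss : ∀ A : Set (EuclideanSpace ℝ (Fin n)), MeasurableSet A →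
      μ A = ∑ i, ENNReal.ofReal (rr i ^ s) * μ (f i ⁻¹' A))
    (hE0 : μ Eᶜ = 0) (i : Fin N) {y : EuclideanSpace ℝ (Fin n)} (hy : y ∈ E)
    {ρ : ℝ} (hρ : rr i * ρ < c) :
    μ (closedBall (f i y) (rr i * ρ)) = ENNReal.ofReal (rr i ^ s) * μ (closedBall y ρ) := by
  rw [hμss _ isClosed_closedBall.measurableSet, Finset.sum_eq_single i]
  · congr 2
    ext z
    simp only [mem_preimage, mem_closedBall, hsim]
    exact mul_le_mul_iff_of_pos_left (hr i).1
  · intro j _ hj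
    have : μ (f j ⁻¹' closedBall (f i y) (rr i * ρ)) = 0 := by
      refine measure_mono_null ?_ hE0
      intro z hz hzE
      have h1 : dist (f j z) (f i y) ≤ rr i * ρ := hz
      linarith [hcdist j i hj z hzE y hy]
    rw [this, mul_zero]
  · simp

/-- the maps `f i` are quasi measure preserving -/
lemma aux_qmp {f : Fin N → EuclideanSpace ℝ (Fin n) → EuclideanSpace ℝ (Fin n)}
    {rr : Fin N → ℝ} (hr : ∀ i, 0 < rr i ∧ rr i < 1)
    (hsim : ∀ i x y, dist (f i x) (f i y) = rr i * dist x y) {s : ℝ}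
    {μ : MeasureTheory.Measure (EuclideanSpace ℝ (Fin n))}
    (hμss : ∀ A : Set (EuclideanSpace ℝ (Fin n)), MeasurableSet A →
      μ A = ∑ i, ENNReal.ofReal (rr i ^ s) * μ (f i ⁻¹' A)) (i : Fin N) :
    Measure.QuasiMeasurePreserving (f i) μ μ := by
  have hm := (aux_continuous hr hsim i).measurable
  refine ⟨hm, Measure.AbsolutelyContinuous.mk fun A hA h0 => ?_⟩
  rw [Measure.map_apply hm hA]
  rw [hμss A hA, Finset.sum_eq_zero_iff] at h0
  have h1 := h0 i (Finset.mem_univ i)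
  rcases mul_eq_zero.1 h1 with h | h
  · exfalso
    rw [ENNReal.ofReal_eq_zero] at h
    exact absurd (Real.rpow_pos_of_pos (hr i).1 s) (not_lt.2 h)
  · exact h

/-- subinvariant sets are a.e. contained in their preimages -/
lemma aux_subinv {f : Fin N → EuclideanSpace ℝ (Fin n) → EuclideanSpace ℝ (Fin n)}
    {rr : Fin N → ℝ} (hr : ∀ i, 0 < rr i ∧ rr i < 1)
    (hsim : ∀ i x y, dist (f i x) (f i y) = rr i * dist x y) {s : ℝ}
    (hsum : ∑ i, rr i ^ s = 1)
    {μ : MeasureTheory.Measure (EuclideanSpace ℝ (Fin n))} (hμ : IsProbabilityMeasure μ)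
    (hμss : ∀ A : Set (EuclideanSpace ℝ (Fin n)), MeasurableSet A →
      μ A = ∑ i, ENNReal.ofReal (rr i ^ s) * μ (f i ⁻¹' A))
    {B : Set (EuclideanSpace ℝ (Fin n))} (hB : MeasurableSet B)
    (hsub : ∀ i, f i ⁻¹' B ≤ᵐ[μ] B) (i : Fin N) : B ≤ᵐ[μ] f i ⁻¹' B := by
  have hw := aux_weights hr hsum
  have hm := (aux_continuous hr hsim i).measurable
  have hle : ∀ j, μ (f j ⁻¹' B) ≤ μ B := fun j => measure_mono_ae (hsub j)
  have hge : μ B ≤ μ (f i ⁻¹' B) := by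
    by_contra hlt
    push Not at hlt
    have h1 : ∑ j, ENNReal.ofReal (rr j ^ s) * μ (f j ⁻¹' B)
        < ∑ j, ENNReal.ofReal (rr j ^ s) * μ B := by
      rw [← Finset.add_sum_erase _ _ (Finset.mem_univ i),
        ← Finset.add_sum_erase Finset.univ (fun j => ENNReal.ofReal (rr j ^ s) * μ B)
          (Finset.mem_univ i)]
      refine ENNReal.add_lt_add_of_lt_of_le ?_ ?_ ?_
      · refine ne_of_lt (ENNReal.sum_lt_top.2 fun j _ => ?_)
        exact ENNReal.mul_lt_top ENNReal.ofReal_lt_top (measure_lt_top _ _)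
      · rw [ENNReal.mul_lt_mul_iff_right]
        · exact hlt
        · rw [Ne, ENNReal.ofReal_eq_zero, not_le]
          exact Real.rpow_pos_of_pos (hr i).1 s
        · exact ENNReal.ofReal_ne_top
      · refine Finset.sum_le_sum fun j _ => ?_
        exact mul_le_mul_right (hle j) _
    rw [← hμss B hB, ← Finset.sum_mul, hw, one_mul] at h1
    exact lt_irrefl _ h1
  exact (ae_eq_of_ae_subset_of_measure_ge (hsub i) hge (hB.preimage hm).nullMeasurableSet
    (measure_ne_top _ _)).symm.le

/-- small cylinders -/
lemma aux_cyl {f : Fin N → EuclideanSpace ℝ (Fin n) → EuclideanSpace ℝ (Fin n)}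
    {rr : Fin N → ℝ} (hr : ∀ i, 0 < rr i ∧ rr i < 1)
    (hsim : ∀ i x y, dist (f i x) (f i y) = rr i * dist x y)
    {E : Set (EuclideanSpace ℝ (Fin n))} (hEcp : IsCompact E)
    (hEinv : E = ⋃ i, f i '' E) (hEdiam : Metric.diam E = 1)
    {s : ℝ} (hsum : ∑ i, rr i ^ s = 1)
    {μ : MeasureTheory.Measure (EuclideanSpace ℝ (Fin n))} (hμ : IsProbabilityMeasure μ)
    (hμss : ∀ A : Set (EuclideanSpace ℝ (Fin n)), MeasurableSet A →
      μ A = ∑ i, ENNReal.ofReal (rr i ^ s) * μ (f i ⁻¹' A))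
    {R : ℝ} (hR0 : 0 < R) (hR : ∀ i, rr i ≤ R) (k : ℕ) :
    ∀ x ∈ E, ∃ g : EuclideanSpace ℝ (Fin n) → EuclideanSpace ℝ (Fin n),
      MapsTo g E E ∧ MapsTo g E (closedBall x (R ^ k)) ∧
      Measure.QuasiMeasurePreserving g μ μ ∧
      ∀ B : Set (EuclideanSpace ℝ (Fin n)), MeasurableSet B →
        (∀ i, f i ⁻¹' B ≤ᵐ[μ] B) → B ≤ᵐ[μ] g ⁻¹' B := by
  induction k with
  | zero =>
    intro x hx
    refine ⟨id, mapsTo_id _, ?_, Measure.QuasiMeasurePreserving.id μ, fun B _ _ => ?_⟩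
    · intro y hy
      rw [mem_closedBall, pow_zero, ← hEdiam]
      exact dist_le_diam_of_mem hEcp.isBounded hy hx
    · exact Filter.EventuallyLE.rfl
  | succ k ih =>
    intro x hx
    rw [hEinv] at hx
    obtain ⟨i, x', hx', rfl⟩ := mem_iUnion.1 hx
    obtain ⟨g, h1, h2, h3, h4⟩ := ih x' hx'
    refine ⟨f i ∘ g, ?_, ?_, (aux_qmp hr hsim hμss i).comp h3, ?_⟩
    · intro y hy
      rw [hEinv]
      exact mem_iUnion.2 ⟨i, g y, h1 hy, rfl⟩
    · intro y hy
      have h5 : dist (g y) x' ≤ R ^ k := h2 hy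
      rw [mem_closedBall, Function.comp_apply, hsim, pow_succ, mul_comm (R ^ k)]
      have := hR i
      gcongr
    · intro B hB hsub
      refine (h4 B hB hsub).trans ?_
      rw [preimage_comp]
      exact h3.preimage_mono_ae (aux_subinv hr hsim hsum hμ hμss hB hsub i)

/-- iterated images of a set -/
def auxG (f : Fin N → EuclideanSpace ℝ (Fin n) → EuclideanSpace ℝ (Fin n))
    (V : Set (EuclideanSpace ℝ (Fin n))) : ℕ → Set (EuclideanSpace ℝ (Fin n))
  | 0 => V
  | k + 1 => ⋃ i, f i '' auxG f V k

/-- almost every point lies in arbitrarily deep copies of `V` -/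
lemma aux_recur {f : Fin N → EuclideanSpace ℝ (Fin n) → EuclideanSpace ℝ (Fin n)}
    {rr : Fin N → ℝ} (hr : ∀ i, 0 < rr i ∧ rr i < 1)
    (hsim : ∀ i x y, dist (f i x) (f i y) = rr i * dist x y)
    {E : Set (EuclideanSpace ℝ (Fin n))}
    {s : ℝ} (hsum : ∑ i, rr i ^ s = 1)
    {μ : MeasureTheory.Measure (EuclideanSpace ℝ (Fin n))} (hμ : IsProbabilityMeasure μ)
    (hμss : ∀ A : Set (EuclideanSpace ℝ (Fin n)), MeasurableSet A →
      μ A = ∑ i, ENNReal.ofReal (rr i ^ s) * μ (f i ⁻¹' A))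
    (hE0 : μ Eᶜ = 0)
    {V : Set (EuclideanSpace ℝ (Fin n))} (hV : IsCompact V)
    {g : EuclideanSpace ℝ (Fin n) → EuclideanSpace ℝ (Fin n)} (hgV : MapsTo g E V)
    (hgB : ∀ B : Set (EuclideanSpace ℝ (Fin n)), MeasurableSet B →
        (∀ i, f i ⁻¹' B ≤ᵐ[μ] B) → B ≤ᵐ[μ] g ⁻¹' B) (k : ℕ) :
    μ (⋃ m, auxG f V (k + m))ᶜ = 0 := by
  have hGm : ∀ k, IsCompact (auxG f V k) := by
    intro k
    induction k with
    | zero => exact hV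
    | succ k ih => exact isCompact_iUnion fun i => ih.image (aux_continuous hr hsim i)
  have hm : ∀ k, MeasurableSet (⋃ m, auxG f V (k + m))ᶜ := fun k =>
    (MeasurableSet.iUnion fun m => (hGm _).isClosed.measurableSet).compl
  have hpre : ∀ k i, f i ⁻¹' (⋃ m, auxG f V (k + 1 + m))ᶜ ⊆ (⋃ m, auxG f V (k + m))ᶜ := by
    intro k i z hz hz'
    obtain ⟨m, hm⟩ := mem_iUnion.1 hz'
    apply hz
    refine mem_iUnion.2 ⟨m, ?_⟩
    rw [show k + 1 + m = (k + m) + 1 by ring]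
    exact mem_iUnion.2 ⟨i, z, hm, rfl⟩
  induction k with
  | zero =>
    have hsub : ∀ i, f i ⁻¹' (⋃ m, auxG f V (0 + m))ᶜ ≤ᵐ[μ] (⋃ m, auxG f V (0 + m))ᶜ := by
      intro i
      refine LE.le.eventuallyLE (Subset.trans (preimage_mono ?_) (hpre 0 i))
      rw [compl_subset_compl]
      refine iUnion_subset fun m => ?_
      rw [show 0 + 1 + m = 0 + (m + 1) by ring]
      exact subset_iUnion (fun m => auxG f V (0 + m)) (m + 1)
    have h1 := measure_mono_ae (hgB _ (hm 0) hsub)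
    refine le_antisymm (h1.trans ?_) (zero_le)
    rw [← hE0]
    apply measure_mono
    intro z hz hzE
    exact hz (mem_iUnion.2 ⟨0, hgV hzE⟩)
  | succ k ih =>
    rw [hμss _ (hm _)]
    refine Finset.sum_eq_zero fun i _ => ?_
    rw [measure_mono_null (hpre k i) ih, mul_zero]

/-- lower bound for the packing premeasure from abundance of good balls -/
lemma aux_pack [Nontrivial (EuclideanSpace ℝ (Fin n))] {s : ℝ}
    {μ : MeasureTheory.Measure (EuclideanSpace ℝ (Fin n))} (hμ : IsProbabilityMeasure μ)
    {H : ℝ≥0∞} {G : Set (EuclideanSpace ℝ (Fin n))} (hG0 : μ Gᶜ = 0)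
    (hG : ∀ y ∈ G, ∀ δ > 0, ∃ ρ, 0 < ρ ∧ ρ < δ ∧
      H * μ (closedBall y ρ) ≤ ENNReal.ofReal ((2 * ρ) ^ s))
    (U : Set (EuclideanSpace ℝ (Fin n))) : H * μ U ≤ packPre0 s U := by
  unfold packPre0
  refine le_iInf₂ fun δ hδ => ?_
  obtain ⟨t, r, htc, hts, htr, ht0, htd⟩ := Besicovitch.exists_disjoint_closedBall_covering_ae μ
    (fun y => {ρ | H * μ (closedBall y ρ) ≤ ENNReal.ofReal ((2 * ρ) ^ s)}) (U ∩ G)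
    (fun y hy δ hδ => by
      obtain ⟨ρ, h1, h2, h3⟩ := hG y hy.2 δ hδ
      exact ⟨ρ, h3, h1, h2⟩) (fun _ => δ / 2) (fun _ _ => by positivity)
  have hUμ : μ U ≤ μ (⋃ x ∈ t, closedBall x (r x)) := by
    have hsub : U ⊆ (⋃ x ∈ t, closedBall x (r x)) ∪
        ((U ∩ G) \ ⋃ x ∈ t, closedBall x (r x)) ∪ Gᶜ := by
      intro z hz
      by_cases h1 : z ∈ G
      · by_cases h2 : z ∈ ⋃ x ∈ t, closedBall x (r x)
        · exact Or.inl (Or.inl h2)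
        · exact Or.inl (Or.inr ⟨⟨hz, h1⟩, h2⟩)
      · exact Or.inr h1
    calc μ U ≤ _ := measure_mono hsub
      _ ≤ _ := measure_union_le _ _
      _ ≤ (μ (⋃ x ∈ t, closedBall x (r x)) + 0) + 0 := by
        rw [hG0]
        gcongr
        exact (measure_union_le _ _).trans (by rw [ht0])
      _ = _ := by simp
  rcases t.eq_empty_or_nonempty with hte | ⟨x1, hx1⟩
  · have : μ U = 0 := by simpa [hte] using hUμ
    simp [this]
  haveI : Encodable t := htc.toEncodable
  -- padded enumeration
  let cen : ℕ → 𝔼 := fun k => match Encodable.decode₂ t k with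
    | some x => x
    | none => x1
  let rad : ℕ → ℝ := fun k => match Encodable.decode₂ t k with
    | some x => r x
    | none => -1
  have hcen : ∀ x : t, cen (Encodable.encode x) = x := by
    intro x; simp [cen, Encodable.encodek₂]
  have hrad : ∀ x : t, rad (Encodable.encode x) = r x := by
    intro x; simp [rad, Encodable.encodek₂]
  have hcase : ∀ k, (∃ x : t, Encodable.encode x = k) ∨ (cen k = x1 ∧ rad k = -1) := by
    intro k
    rcases h : Encodable.decode₂ t k with _ | x
    · right; simp [cen, rad, h]
    · left; exact ⟨x, Encodable.decode₂_eq_some.1 h⟩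
  have hempty : closedBall x1 (-1) = ∅ := closedBall_eq_empty.2 (by norm_num)
  have hpack : ∑' i, ENNReal.ofReal (Metric.diam (Metric.closedBall (cen i) (rad i)) ^ s)
      ≤ packPre s δ U := by
    unfold packPre
    refine le_iSup_of_le cen (le_iSup_of_le rad (le_iSup_of_le ?_ (le_iSup_of_le ?_
      (le_iSup_of_le ?_ le_rfl))))
    · intro k
      rcases hcase k with ⟨x, rfl⟩ | ⟨h1, h2⟩
      · rw [hcen]; exact (hts x.2).1
      · rw [h1]; exact (hts hx1).1
    · intro k
      rcases hcase k with ⟨x, rfl⟩ | ⟨h1, h2⟩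
      · rw [hcen, hrad]
        have h3 := (htr x x.2).2
        exact (diam_closedBall h3.1.le).trans (by linarith [h3.2])
      · rw [h1, h2, hempty, diam_empty]; exact hδ.le
    · intro k l hkl
      rcases hcase k with ⟨x, rfl⟩ | ⟨h1, h2⟩
      · rcases hcase l with ⟨y, rfl⟩ | ⟨h3, h4⟩
        · rw [hcen, hrad, hcen, hrad]
          refine htd x.2 y.2 fun h => hkl ?_
          rw [Subtype.ext h]
        · rw [h3, h4, hempty]; exact disjoint_empty _
      · rw [h1, h2, hempty]; exact empty_disjoint _
  refine le_trans ?_ hpack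
  calc H * μ U ≤ H * μ (⋃ x ∈ t, closedBall x (r x)) := by gcongr
    _ ≤ H * ∑' x : t, μ (closedBall (x : 𝔼) (r x)) := by
      gcongr
      exact measure_biUnion_le μ htc _
    _ = ∑' x : t, H * μ (closedBall (x : 𝔼) (r x)) := ENNReal.tsum_mul_left.symm
    _ ≤ ∑' x : t, ENNReal.ofReal (Metric.diam
          (Metric.closedBall (cen (Encodable.encode x)) (rad (Encodable.encode x))) ^ s) := by
      refine ENNReal.tsum_le_tsum fun x => ?_
      rw [hcen, hrad, diam_closedBall_eq _ (htr x x.2).2.1.le]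
      exact (htr x x.2).1
    _ ≤ _ := ENNReal.tsum_comp_le_tsum_of_injective Encodable.encode_injective _

end PackAux

theorem optimal_ball_boundary_meets_E
{n N : ℕ} (hN : 2 ≤ N)
    (f : Fin N → EuclideanSpace ℝ (Fin n) → EuclideanSpace ℝ (Fin n))
    (rr : Fin N → ℝ) (hr : ∀ i, 0 < rr i ∧ rr i < 1)
    (hsim : ∀ i x y, dist (f i x) (f i y) = rr i * dist x y)
    (E : Set (EuclideanSpace ℝ (Fin n))) (hEne : E.Nonempty) (hEcp : IsCompact E)
    (hEinv : E = ⋃ i, f i '' E)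
    (hssc : ∀ i j, i ≠ j → Disjoint (f i '' E) (f j '' E))
(hEdiam : Metric.diam E = 1)
(rmin : ℝ) (hrmin : IsLeast (Set.range rr) rmin)
(c : ℝ) (hc : 0 < c)
    (hcdef : c = sInf {d : ℝ | ∃ i j : Fin N, i ≠ j ∧
      ∃ u ∈ f i '' E, ∃ v ∈ f j '' E, d = dist u v})
(s : ℝ) (hs : 0 < s) (hsum : ∑ i, rr i ^ s = 1)
    (μ : MeasureTheory.Measure (EuclideanSpace ℝ (Fin n))) (hμ : IsProbabilityMeasure μ)
    (hμss : ∀ A : Set (EuclideanSpace ℝ (Fin n)), MeasurableSet A →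
      μ A = ∑ i, ENNReal.ofReal (rr i ^ s) * μ (f i ⁻¹' A))
    (a : ℝ) (ha : 0 < a) (ha' : a ≤ c / rmin)
    (x0 : EuclideanSpace ℝ (Fin n)) (hx0 : x0 ∈ E)
    (d0 : ℝ) (hd0 : d0 ∈ Set.Icc (a * rmin) a)
    (hopt : packM s E = densityh μ s x0 d0) :
    d0 = a ∨ (Metric.sphere x0 d0 ∩ E).Nonempty := by
  by_contra hcon
  push Not at hcon
  obtain ⟨hda, hsph⟩ := hcon
  have hda : d0 < a := lt_of_le_of_ne hd0.2 hda
  obtain ⟨⟨j, hj⟩, hjmin⟩ := hrmin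
  subst hj
  have hrj := (hr j).1
  have hd0pos : 0 < d0 := lt_of_lt_of_le (mul_pos ha hrj) hd0.1
  -- maximal ratio
  haveI : Nonempty (Fin N) := ⟨j⟩
  obtain ⟨i1, hi1⟩ := Finite.exists_max rr
  have hR0 := (hr i1).1
  have hR1 := (hr i1).2
  generalize rr i1 = R at hi1 hR0 hR1
  have hE0 : μ Eᶜ = 0 :=
    aux_support hr hsim hEne hEcp hEinv hsum hμ hμss hR0 hR1 hi1
  have hE1 : μ E ≠ 0 := by
    intro h
    have h1 : μ univ ≤ μ E + μ Eᶜ := by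
      rw [← union_compl_self E]; exact measure_union_le _ _
    rw [h, hE0, measure_univ] at h1
    simp at h1
  have hfE : ∀ i, ∀ y ∈ E, f i y ∈ E := fun i y hy => by
    rw [hEinv]; exact mem_iUnion.2 ⟨i, y, hy, rfl⟩
  have hcdist : ∀ i j, i ≠ j → ∀ u ∈ E, ∀ v ∈ E, c ≤ dist (f i u) (f j v) := by
    intro i j hij u hu v hv
    rw [hcdef]
    refine csInf_le ⟨0, ?_⟩ ⟨i, j, hij, _, ⟨u, hu, rfl⟩, _, ⟨v, hv, rfl⟩, rfl⟩
    rintro _ ⟨_, _, _, _, _, _, _, rfl⟩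
    exact dist_nonneg
  haveI : Nontrivial (EuclideanSpace ℝ (Fin n)) := by
    by_contra h
    rw [not_nontrivial_iff_subsingleton] at h
    have := Metric.diam_subsingleton (s := E) (Set.subsingleton_of_subsingleton)
    rw [hEdiam] at this
    norm_num at this
  -- the ball has positive mass
  have hcyl : ∀ η > 0, ∃ g : EuclideanSpace ℝ (Fin n) → EuclideanSpace ℝ (Fin n),
      MapsTo g E E ∧ MapsTo g E (closedBall x0 η) ∧
      Measure.QuasiMeasurePreserving g μ μ ∧
      ∀ B : Set (EuclideanSpace ℝ (Fin n)), MeasurableSet B →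
        (∀ i, f i ⁻¹' B ≤ᵐ[μ] B) → B ≤ᵐ[μ] g ⁻¹' B := by
    intro η hη
    obtain ⟨k, hk⟩ := exists_pow_lt_of_lt_one hη hR1
    obtain ⟨g, h1, h2, h3, h4⟩ :=
      aux_cyl hr hsim hEcp hEinv hEdiam hsum hμ hμss hR0 hi1 k x0 hx0
    exact ⟨g, h1, h2.mono_right (closedBall_subset_closedBall hk.le), h3, h4⟩
  have hm0 : μ (closedBall x0 d0) ≠ 0 := by
    intro h
    obtain ⟨g, h1, h2, h3, h4⟩ := hcyl d0 hd0pos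
    exact hE1 (measure_mono_null h2 (h3.preimage_null h))
  -- the gap
  obtain ⟨ε, hε, hgap⟩ : ∃ ε > 0, ∀ z ∈ E, dist z x0 ≤ d0 + ε → dist z x0 ≤ d0 := by
    have hK : IsCompact (E \ ball x0 d0) := hEcp.diff isOpen_ball
    rcases (E \ ball x0 d0).eq_empty_or_nonempty with he | hne
    · refine ⟨1, one_pos, fun z hz _ => ?_⟩
      by_contra hlt
      have : z ∈ E \ ball x0 d0 := ⟨hz, fun h => hlt (le_of_lt h)⟩
      rw [he] at this
      exact this
    · obtain ⟨z0, hz0, hz0min⟩ := hK.exists_isMinOn hne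
        (f := fun z => dist z x0) (by fun_prop)
      have h1 : d0 ≤ dist z0 x0 := not_lt.1 hz0.2
      have h2 : d0 ≠ dist z0 x0 := by
        intro h
        have : z0 ∈ sphere x0 d0 ∩ E := ⟨h.symm, hz0.1⟩
        rw [hsph] at this
        exact this
      have h3 : d0 < dist z0 x0 := lt_of_le_of_ne h1 h2
      refine ⟨(dist z0 x0 - d0) / 2, by linarith, fun z hz hzd => ?_⟩
      by_contra hlt
      have h4 : dist z0 x0 ≤ dist z x0 := hz0min ⟨hz, fun h => hlt (le_of_lt h)⟩
      linarith
  obtain ⟨d1, hd01, hd1a, hd1ε⟩ : ∃ d1, d0 < d1 ∧ d1 < a ∧ d1 ≤ d0 + ε / 2 :=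
    ⟨min (d0 + ε / 2) ((d0 + a) / 2), lt_min (by linarith) (by linarith),
      lt_of_le_of_lt (min_le_right _ _) (by linarith), min_le_left _ _⟩
  have hd1pos : 0 < d1 := hd0pos.trans hd01
  have hjc : rr j * d1 < c := by
    have h1 : d1 < c / rr j := lt_of_lt_of_le hd1a ha'
    rw [lt_div_iff₀ hrj] at h1
    linarith
  set H : ℝ≥0∞ := ENNReal.ofReal ((2 * d1) ^ s) / μ (closedBall x0 d0) with hH
  have hHlt : packM s E < H := by
    rw [hopt, densityh, hH]
    refine ENNReal.div_lt_div_right hm0 (measure_ne_top _ _) ?_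
    rw [ENNReal.ofReal_lt_ofReal_iff (by positivity)]
    exact Real.rpow_lt_rpow (by positivity) (by linarith) hs
  have hscale : ∀ i, ∀ y ∈ E, ∀ ρ, 0 < ρ → rr i * ρ < c →
      H * μ (closedBall y ρ) ≤ ENNReal.ofReal ((2 * ρ) ^ s) →
      H * μ (closedBall (f i y) (rr i * ρ)) ≤ ENNReal.ofReal ((2 * (rr i * ρ)) ^ s) := by
    intro i y hy ρ hρ hρc hle
    have hri := (hr i).1
    rw [aux_ball hr hsim hcdist hμss hE0 i hy hρc, mul_left_comm,
      show 2 * (rr i * ρ) = rr i * (2 * ρ) by ring,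
      Real.mul_rpow hri.le (by positivity), ENNReal.ofReal_mul (by positivity)]
    gcongr
  -- the set of good base points
  set V := f j '' (E ∩ closedBall x0 (ε / 2)) with hV
  have hVc : IsCompact V :=
    (hEcp.inter_right isClosed_closedBall).image (aux_continuous hr hsim j)
  obtain ⟨g, hg1, hg2, hg3, hg4⟩ := hcyl (ε / 2) (by positivity)
  have hrec := aux_recur hr hsim hsum hμ hμss hE0 hVc (g := f j ∘ g)
    (fun z hz => ⟨g z, ⟨hg1 hz, hg2 hz⟩, rfl⟩)
    (fun B hB hsub => (hg4 B hB hsub).trans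
      (by
        rw [preimage_comp]
        exact hg3.preimage_mono_ae (aux_subinv hr hsim hsum hμ hμss hB hsub j)))
  have hgood : ∀ k, ∀ y ∈ auxG f V k, y ∈ E ∧ ∃ ρ, 0 < ρ ∧ ρ < c ∧ ρ ≤ c * R ^ k ∧
      H * μ (closedBall y ρ) ≤ ENNReal.ofReal ((2 * ρ) ^ s) := by
    intro k
    induction k with
    | zero =>
      rintro _ ⟨y, ⟨hyE, hyb⟩, rfl⟩
      refine ⟨hfE j y hyE, rr j * d1, by positivity, hjc, by simpa using hjc.le, ?_⟩
      refine hscale j y hyE d1 hd1pos hjc ?_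
      have hle : μ (closedBall y d1) ≤ μ (closedBall x0 d0) := by
        have hsub : closedBall y d1 ⊆ closedBall x0 d0 ∪ Eᶜ := by
          intro z hz
          by_cases hzE : z ∈ E
          · left
            refine hgap z hzE ?_
            have h1 : dist z y ≤ d1 := hz
            have h2 : dist y x0 ≤ ε / 2 := hyb
            linarith [dist_triangle z y x0]
          · exact Or.inr hzE
        calc _ ≤ _ := measure_mono hsub
          _ ≤ _ := measure_union_le _ _
          _ = _ := by rw [hE0, add_zero]
      calc H * μ (closedBall y d1) ≤ H * μ (closedBall x0 d0) := by gcongr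
        _ = _ := ENNReal.div_mul_cancel hm0 (measure_ne_top _ _)
    | succ k ih =>
      intro z hz
      obtain ⟨i, y, hy, rfl⟩ := mem_iUnion.1 hz
      obtain ⟨hyE, ρ, h1, h2, h3, h4⟩ := ih y hy
      have hri := hr i
      have h5 : rr i * ρ < c := by nlinarith
      refine ⟨hfE i y hyE, rr i * ρ, mul_pos hri.1 h1, h5, ?_, hscale i y hyE ρ h1 h5 h4⟩
      calc rr i * ρ ≤ R * (c * R ^ k) := by
            have := hi1 i
            gcongr
        _ = _ := by ring
  let G : Set (EuclideanSpace ℝ (Fin n)) := ⋂ k, ⋃ m, auxG f V (k + m)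
  have hG0 : μ Gᶜ = 0 := by
    simp only [G, compl_iInter]
    exact measure_iUnion_null hrec
  have hG : ∀ y ∈ G, ∀ δ > 0, ∃ ρ, 0 < ρ ∧ ρ < δ ∧
      H * μ (closedBall y ρ) ≤ ENNReal.ofReal ((2 * ρ) ^ s) := by
    intro y hy δ hδ
    obtain ⟨k, hk⟩ := exists_pow_lt_of_lt_one (show 0 < δ / c by positivity) hR1
    obtain ⟨m, hm⟩ := mem_iUnion.1 (mem_iInter.1 hy k)
    obtain ⟨-, ρ, h1, h2, h3, h4⟩ := hgood _ y hm
    refine ⟨ρ, h1, ?_, h4⟩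
    rw [lt_div_iff₀ hc] at hk
    have h5 : R ^ (k + m) ≤ R ^ k := pow_le_pow_of_le_one hR0.le hR1.le (Nat.le_add_right _ _)
    nlinarith
  have hfin : H ≤ packM s E := by
    unfold packM
    refine le_iInf₂ fun U hU => ?_
    calc H = H * μ univ := by simp
      _ ≤ H * (μ E + μ Eᶜ) := by
        gcongr
        rw [← union_compl_self E]; exact measure_union_le _ _
      _ = H * μ E := by rw [hE0, add_zero]
      _ ≤ H * ∑' i, μ (U i) := by
        gcongr
        exact (measure_mono hU).trans (measure_iUnion_le _)
      _ = ∑' i, H * μ (U i) := ENNReal.tsum_mul_left.symm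
      _ ≤ _ := ENNReal.tsum_le_tsum fun i => aux_pack hμ hG0 hG (U i)
  exact absurd hHlt (not_lt.2 hfin)
end

section
/- For every a ∈ (0, c/r_min], the packing measure is attained on the half-open range of radii: P^s(E) = max{ h(x,d) : x ∈ E and d ∈ [a·r_min, a) }. -/
open Metric Set MeasureTheory Filter Topology
open scoped ENNReal NNReal

section Aux

/-- The standing hypotheses, bundled. -/
structure Setup {n N : ℕ}
    (f : Fin N → EuclideanSpace ℝ (Fin n) → EuclideanSpace ℝ (Fin n))
    (rr : Fin N → ℝ) (E : Set (EuclideanSpace ℝ (Fin n))) (s c ρ : ℝ)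
    (μ : MeasureTheory.Measure (EuclideanSpace ℝ (Fin n))) : Prop where
  hr : ∀ i, 0 < rr i
  hρ0 : 0 < ρ
  hρ1 : ρ < 1
  hrρ : ∀ i, rr i ≤ ρ
  hsim : ∀ i x y, dist (f i x) (f i y) = rr i * dist x y
  hEne : E.Nonempty
  hEcp : IsCompact E
  hEinv : E = ⋃ i, f i '' E
  hEdiam : Metric.diam E = 1
  hsep : ∀ i j, i ≠ j → ∀ u ∈ E, ∀ v ∈ E, c ≤ dist (f i u) (f j v)
  hs : 0 < s
  hsum : ∑ i, rr i ^ s = 1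
  hμ : IsProbabilityMeasure μ
  hμss : ∀ A : Set (EuclideanSpace ℝ (Fin n)), MeasurableSet A →
      μ A = ∑ i, ENNReal.ofReal (rr i ^ s) * μ (f i ⁻¹' A)

namespace Setup

variable {n N : ℕ}
    {f : Fin N → EuclideanSpace ℝ (Fin n) → EuclideanSpace ℝ (Fin n)}
    {rr : Fin N → ℝ} {E : Set (EuclideanSpace ℝ (Fin n))} {s c ρ : ℝ}
    {μ : MeasureTheory.Measure (EuclideanSpace ℝ (Fin n))}

lemma emb (H : Setup f rr E s c ρ μ) (i : Fin N) : MeasurableEmbedding (f i) := by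
  have hr := H.hr i
  have hL : LipschitzWith (rr i).toNNReal (f i) :=
    LipschitzWith.of_dist_le_mul fun x y => by
      rw [H.hsim, Real.coe_toNNReal _ hr.le]
  have hA : AntilipschitzWith ((rr i)⁻¹).toNNReal (f i) :=
    AntilipschitzWith.of_le_mul_dist fun x y => by
      rw [H.hsim, Real.coe_toNNReal _ (inv_pos.2 hr).le, inv_mul_cancel_left₀ hr.ne']
  exact (hA.isClosedEmbedding hL.uniformContinuous).measurableEmbedding

lemma cont (H : Setup f rr E s c ρ μ) (i : Fin N) : Continuous (f i) := by
  have hL : LipschitzWith (rr i).toNNReal (f i) :=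
    LipschitzWith.of_dist_le_mul fun x y => by
      rw [H.hsim, Real.coe_toNNReal _ (H.hr i).le]
  exact hL.continuous

lemma ss (H : Setup f rr E s c ρ μ) (A : Set (EuclideanSpace ℝ (Fin n))) :
    μ A = ∑ i, ENNReal.ofReal (rr i ^ s) * μ (f i ⁻¹' A) := by
  have h : μ = ∑ i, ENNReal.ofReal (rr i ^ s) • μ.map (f i) := by
    ext A hA
    rw [H.hμss A hA]
    simp [Measure.finsetSum_apply, (H.emb _).map_apply]
  conv_lhs => rw [h]
  simp [Measure.finsetSum_apply, (H.emb _).map_apply]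

lemma ppos (H : Setup f rr E s c ρ μ) (i : Fin N) : ENNReal.ofReal (rr i ^ s) ≠ 0 := by
  have := Real.rpow_pos_of_pos (H.hr i) s
  simpa using this

lemma psum (H : Setup f rr E s c ρ μ) : ∑ i, ENNReal.ofReal (rr i ^ s) = 1 := by
  rw [← ENNReal.ofReal_sum_of_nonneg (fun i _ => (Real.rpow_pos_of_pos (H.hr i) s).le), H.hsum]
  simp

lemma fmem (H : Setup f rr E s c ρ μ) (i : Fin N) {x} (hx : x ∈ E) : f i x ∈ E := by
  rw [H.hEinv]; exact mem_iUnion.2 ⟨i, x, hx, rfl⟩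

lemma exi (H : Setup f rr E s c ρ μ) {x} (hx : x ∈ E) : ∃ i, ∃ y ∈ E, f i y = x := by
  rw [H.hEinv] at hx
  simpa using hx

/-- if all `m i ≤ M` and the weighted average is `M` then all are `M`. -/
lemma avg (H : Setup f rr E s c ρ μ) {M : ℝ≥0∞} (hM : M ≠ ⊤) (m : Fin N → ℝ≥0∞)
    (hm : ∀ i, m i ≤ M) (h : M = ∑ i, ENNReal.ofReal (rr i ^ s) * m i) (i : Fin N) :
    m i = M := by
  by_contra hne
  have hlt : m i < M := lt_of_le_of_ne (hm i) hne
  have : ∑ i, ENNReal.ofReal (rr i ^ s) * m i < ∑ i, ENNReal.ofReal (rr i ^ s) * M := by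
    have hfin : ∀ j, m j ≠ ⊤ := fun j => ne_top_of_le_ne_top hM (hm j)
    rw [← Finset.add_sum_erase _ _ (Finset.mem_univ i), 
      ← Finset.add_sum_erase (a := i) _ (fun i => ENNReal.ofReal (rr i ^ s) * M) (Finset.mem_univ i)]
    refine ENNReal.add_lt_add_of_lt_of_le ?_ ?_ ?_
    · exact (ENNReal.sum_lt_top.2 fun j _ => ENNReal.mul_lt_top (by simp) (hfin j).lt_top).ne
    · exact (ENNReal.mul_lt_mul_iff_right (H.ppos i) (by simp)).2 hlt
    · exact Finset.sum_le_sum fun j _ => by gcongr; exact hm j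
  rw [← h, ← Finset.sum_mul, H.psum, one_mul] at this
  exact lt_irrefl _ this

lemma null_compl (H : Setup f rr E s c ρ μ) : μ Eᶜ = 0 := by
  have := H.hμ
  have h1 : ∀ R : ℝ, μ {x | R < infDist x E} ≤ μ {x | R / ρ < infDist x E} ∨ R ≤ 0 := by
    intro R
    by_cases hR : R ≤ 0
    · exact Or.inr hR
    left
    push Not at hR
    rw [H.ss]
    calc _ ≤ ∑ i, ENNReal.ofReal (rr i ^ s) * μ {x | R / ρ < infDist x E} := by
          refine Finset.sum_le_sum fun i _ => ?_
          gcongr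
          intro x hx
          simp only [mem_preimage, mem_ofPred_eq] at hx ⊢
          obtain ⟨y, hy, hxy⟩ := H.hEcp.exists_infDist_eq_dist H.hEne x
          have h2 := infDist_le_dist_of_mem (x := f i x) (H.fmem i hy)
          rw [H.hsim, ← hxy] at h2
          rw [div_lt_iff₀ H.hρ0]
          have := H.hrρ i
          have : 0 ≤ infDist x E := infDist_nonneg
          nlinarith
      _ = _ := by rw [← Finset.sum_mul, H.psum, one_mul]
  have h2 : ∀ R : ℝ, 0 < R → ∀ k : ℕ, μ {x | R < infDist x E} ≤ μ {x | R / ρ ^ k < infDist x E} := by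
    intro R hR k
    induction k with
    | zero => simp
    | succ k ih =>
      refine ih.trans ?_
      have hp : 0 < R / ρ ^ k := div_pos hR (pow_pos H.hρ0 k)
      have := (h1 (R / ρ ^ k)).resolve_right (not_le.2 hp)
      rwa [div_div, ← pow_succ] at this
  have h3 : ∀ R : ℝ, 0 < R → μ {x | R < infDist x E} = 0 := by
    intro R hR
    have hat : Tendsto (fun k : ℕ => R / ρ ^ k) atTop atTop := by
      have : Tendsto (fun k : ℕ => R * (ρ⁻¹) ^ k) atTop atTop :=
        Tendsto.const_mul_atTop hR (tendsto_pow_atTop_atTop_of_one_lt ((one_lt_inv₀ H.hρ0).2 H.hρ1))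
      simpa [div_eq_mul_inv] using this
    have : Tendsto (fun k : ℕ => μ {x | R / ρ ^ k < infDist x E}) atTop (𝓝 (μ ∅)) := by
      refine tendsto_measure_of_ae_tendsto_indicator_of_isFiniteMeasure _ MeasurableSet.empty
        (fun k => measurableSet_lt measurable_const (measurable_infDist)) ?_
      refine Eventually.of_forall fun x => ?_
      filter_upwards [hat.eventually_ge_atTop (infDist x E)] with k hk
      simpa using hk
    rw [measure_empty] at this
    exact le_antisymm (ge_of_tendsto' this (h2 R hR)) zero_le
  have h4 : Eᶜ ⊆ ⋃ k : ℕ, {x | 1 / ((k : ℝ) + 1) < infDist x E} := by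
    intro x hx
    have : 0 < infDist x E := (H.hEcp.isClosed.notMem_iff_infDist_pos H.hEne).1 hx
    obtain ⟨k, hk⟩ := exists_nat_one_div_lt this
    exact mem_iUnion.2 ⟨k, hk⟩
  exact measure_mono_null h4 (measure_iUnion_null fun k => h3 _ (by positivity))

lemma meas_E (H : Setup f rr E s c ρ μ) : μ E = 1 := by
  have := H.hμ
  have h := prob_compl_eq_zero_iff (μ := μ) H.hEcp.measurableSet
  exact h.1 H.null_compl

/-- If `B` misses `E` then it is null. -/
lemma null_of_disj (H : Setup f rr E s c ρ μ) {B : Set (EuclideanSpace ℝ (Fin n))}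
    (h : ∀ x ∈ E, x ∉ B) : μ B = 0 :=
  measure_mono_null (fun x hx hxE => h x hxE hx) H.null_compl

/-- Cylinder induction. -/
lemma cyl (H : Setup f rr E s c ρ μ) (Q : Set (EuclideanSpace ℝ (Fin n)) → Prop)
    (hQ : ∀ A i, Q A → Q (f i ⁻¹' A)) {x} (hx : x ∈ E) {U} (hU : U ∈ 𝓝 x) (hQU : Q U) :
    ∃ A, E ⊆ A ∧ Q A := by
  have key : ∀ k : ℕ, ∀ x ∈ E, ∀ U, closedBall x (ρ ^ k) ⊆ U → Q U → ∃ A, E ⊆ A ∧ Q A := by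
    intro k
    induction k with
    | zero =>
      intro x hx U hU hQ
      refine ⟨U, fun y hy => hU ?_, hQ⟩
      rw [mem_closedBall, pow_zero, ← H.hEdiam]
      exact dist_le_diam_of_mem H.hEcp.isBounded hy hx
    | succ k ih =>
      intro x hx U hU hQU
      obtain ⟨i, y, hy, rfl⟩ := H.exi hx
      refine ih y hy (f i ⁻¹' U) (fun z hz => hU ?_) (hQ _ _ hQU)
      rw [mem_closedBall] at hz ⊢
      rw [H.hsim, pow_succ']
      exact mul_le_mul (H.hrρ i) hz dist_nonneg H.hρ0.le
  obtain ⟨η, hη, hηU⟩ := Metric.mem_nhds_iff.1 hU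
  obtain ⟨k, hk⟩ := exists_pow_lt_of_lt_one hη H.hρ1
  exact key k x hx U ((closedBall_subset_ball hk).trans hηU) hQU

lemma pos_of_nhds (H : Setup f rr E s c ρ μ) {x} (hx : x ∈ E) {U} (hU : U ∈ 𝓝 x) : μ U ≠ 0 := by
  intro h0
  obtain ⟨A, hA, hA0⟩ := H.cyl (fun A => μ A = 0) (fun A i hA => by
    rw [H.ss, Finset.sum_eq_zero_iff] at hA
    exact (mul_eq_zero.1 (hA i (Finset.mem_univ i))).resolve_left (H.ppos i)) hx hU h0
  have := measure_mono_null hA hA0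
  rw [H.meas_E] at this
  exact one_ne_zero this

/-- zero-one type lemma -/
lemma zero_one (H : Setup f rr E s c ρ μ) (C : Set (EuclideanSpace ℝ (Fin n)) → Prop) {M : ℝ≥0∞}
    (hM : ∀ B, C B → μ B ≤ M) (hC : ∀ B i, C B → C (f i ⁻¹' B))
    {B₀} (hB₀ : C B₀) (hBM : μ B₀ = M) {x} (hx : x ∈ E) (hU : B₀ᶜ ∈ 𝓝 x) : M = 0 := by
  have := H.hμ
  obtain ⟨A, hA, B, hB, hBM, hAB⟩ := H.cyl (fun A => ∃ B, C B ∧ μ B = M ∧ ∀ x ∈ A, x ∉ B)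
    (fun A i ⟨B, hB, hBM, hAB⟩ => ⟨f i ⁻¹' B, hC B i hB, by
      refine H.avg (hBM ▸ measure_ne_top μ B) (fun i => μ (f i ⁻¹' B)) (fun i => hM _ (hC B i hB)) ?_ i
      rw [← hBM]; exact H.ss B, fun x hx => hAB _ hx⟩) hx hU ⟨B₀, hB₀, hBM, fun x hx => hx⟩
  rw [← hBM]
  exact H.null_of_disj fun x hx => hAB x (hA hx)

lemma dens_scale (H : Setup f rr E s c ρ μ) {x} (hx : x ∈ E) {d : ℝ} (hd : 0 < d) (i : Fin N)
    (hdc : rr i * d < c) : densityh μ s (f i x) (rr i * d) = densityh μ s x d := by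
  have h1 : μ (closedBall (f i x) (rr i * d)) = ENNReal.ofReal (rr i ^ s) * μ (closedBall x d) := by
    rw [H.ss, Finset.sum_eq_single i]
    · congr 2
      ext y
      simp only [mem_preimage, mem_closedBall, H.hsim]
      exact mul_le_mul_iff_right₀ (H.hr i)
    · intro j _ hj
      rw [H.null_of_disj, mul_zero]
      intro y hy hy'
      rw [mem_preimage, mem_closedBall] at hy'
      have := H.hsep j i hj y hy x hx
      linarith
    · simp
  unfold densityh
  rw [h1, show 2 * (rr i * d) = rr i * (2 * d) by ring,
    Real.mul_rpow (H.hr i).le (by positivity), ENNReal.ofReal_mul (Real.rpow_nonneg (H.hr i).le _),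
    ENNReal.mul_div_mul_left _ _ (H.ppos i) (by simp)]


/-- squared distance to `p` on `E` -/
noncomputable def sqd (E : Set (EuclideanSpace ℝ (Fin n))) (p : EuclideanSpace ℝ (Fin n)) : C(E, ℝ) :=
  ⟨fun x => dist (x : EuclideanSpace ℝ (Fin n)) p ^ 2, by fun_prop⟩

/-- span of constants and squared distances -/
noncomputable def quadW (E : Set (EuclideanSpace ℝ (Fin n))) : Submodule ℝ C(E, ℝ) :=
  Submodule.span ℝ ({1} ∪ range (sqd E))

lemma quadW_fin (E : Set (EuclideanSpace ℝ (Fin n))) : FiniteDimensional ℝ (quadW E) := by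
  let co : Fin n → C(E, ℝ) := fun j => ⟨fun x => (x : EuclideanSpace ℝ (Fin n)) j, by fun_prop⟩
  let S : Set C(E, ℝ) := {1} ∪ {sqd E 0} ∪ range co
  have hS : S.Finite := ((finite_singleton _).union (finite_singleton _)).union (finite_range co)
  have : FiniteDimensional ℝ (Submodule.span ℝ S) := FiniteDimensional.span_of_finite ℝ hS
  refine Submodule.finiteDimensional_of_le (S₂ := Submodule.span ℝ S) ?_
  unfold quadW
  rw [Submodule.span_le]
  rintro g (hg | ⟨p, rfl⟩)
  · exact Submodule.subset_span (Or.inl (Or.inl hg))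
  · have : sqd E p = sqd E 0 - (2 : ℝ) • ∑ j, (p j) • co j + (‖p‖ ^ 2) • (1 : C(E, ℝ)) := by
      ext x
      simp only [sqd, co, ContinuousMap.coe_mk, ContinuousMap.add_apply, ContinuousMap.sub_apply,
        ContinuousMap.smul_apply, ContinuousMap.one_apply, ContinuousMap.sum_apply, smul_eq_mul,
        dist_eq_norm, sub_zero, mul_one]
      rw [@norm_sub_sq ℝ]
      simp [PiLp.inner_apply]
    rw [this]
    refine Submodule.add_mem _ (Submodule.sub_mem _ ?_ (Submodule.smul_mem _ _ (Submodule.sum_mem _ fun j _ =>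
      Submodule.smul_mem _ _ ?_))) (Submodule.smul_mem _ _ ?_)
    · exact Submodule.subset_span (Or.inl (Or.inr rfl))
    · exact Submodule.subset_span (Or.inr ⟨j, rfl⟩)
    · exact Submodule.subset_span (Or.inl (Or.inl rfl))

/-- restriction of `f i` to `E` -/
def fE (H : Setup f rr E s c ρ μ) (i : Fin N) : C(E, E) :=
  ⟨fun x => ⟨f i x, H.fmem i x.2⟩, by have := H.cont i; fun_prop⟩

lemma comp_mem (H : Setup f rr E s c ρ μ) (i : Fin N) (g : C(E, ℝ)) (hg : g ∈ quadW E)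
    (hg0 : g ≠ 0) : g.comp (H.fE i) ∈ quadW E ∧ g.comp (H.fE i) ≠ 0 := by
  have := quadW_fin E
  let T : C(E, ℝ) →ₗ[ℝ] C(E, ℝ) := (ContinuousMap.compRightAlgHom ℝ ℝ (H.fE i)).toLinearMap
  have hT : ∀ g, T g = g.comp (H.fE i) := fun g => rfl
  have hle : quadW E ≤ (quadW E).map T := by
    conv_lhs => unfold quadW
    rw [Submodule.span_le]
    rintro g (hg | ⟨p, rfl⟩)
    · refine ⟨1, Submodule.subset_span (Or.inl rfl), ?_⟩
      rw [mem_singleton_iff.1 hg]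
      ext x; simp [hT]
    · refine ⟨(rr i ^ 2)⁻¹ • sqd E (f i p), Submodule.smul_mem _ _ (Submodule.subset_span (Or.inr ⟨_, rfl⟩)), ?_⟩
      ext x
      have := (H.hr i).ne'
      simp only [hT, sqd, fE, ContinuousMap.comp_apply, ContinuousMap.smul_apply, ContinuousMap.coe_mk,
        H.hsim, smul_eq_mul]
      field_simp
  have heq : quadW E = (quadW E).map T :=
    Submodule.eq_of_le_of_finrank_le hle (Submodule.finrank_map_le T _)
  have hmaps : ∀ g ∈ quadW E, T g ∈ quadW E := fun g hg => by
    rw [heq]; exact ⟨g, hg, rfl⟩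
  refine ⟨hmaps g hg, fun h0 => hg0 ?_⟩
  have hsurj : Function.Surjective (T.restrict hmaps) := by
    rintro ⟨y, hy⟩
    rw [heq] at hy
    obtain ⟨z, hz, rfl⟩ := hy
    exact ⟨⟨z, hz⟩, rfl⟩
  have hinj := LinearMap.injective_iff_surjective.2 hsurj
  have : (⟨g, hg⟩ : quadW E) = 0 := hinj (by
    rw [map_zero]; exact Subtype.ext h0)
  exact congrArg Subtype.val this

lemma closed_sub (H : Setup f rr E s c ρ μ) {Z : Set E} (hZ : IsClosed Z) :
    IsClosed (Subtype.val '' Z) :=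
  (H.hEcp.isClosed.isClosedEmbedding_subtypeVal).isClosedMap _ hZ

lemma quad_null (H : Setup f rr E s c ρ μ) (g : C(E, ℝ)) (hg : g ∈ quadW E)
    (hg0 : g ≠ 0) : μ (Subtype.val '' {x : E | g x = 0}) = 0 := by
  have := H.hμ
  have := quadW_fin E
  have : CompactSpace E := isCompact_iff_compactSpace.1 H.hEcp
  let F : quadW E → ℝ≥0∞ := fun g => μ (Subtype.val '' {x : E | (g : C(E, ℝ)) x = 0})
  have husc : UpperSemicontinuous F := by
    intro g y hy
    have ht : Tendsto (fun m : ℕ => μ (Subtype.val '' {x : E | |(g : C(E, ℝ)) x| ≤ 1 / ((m : ℝ) + 1)}))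
        atTop (𝓝 (F g)) := by
      refine tendsto_measure_of_ae_tendsto_indicator_of_isFiniteMeasure _
        (H.closed_sub (isClosed_eq (by fun_prop) (by fun_prop))).measurableSet
        (fun k => (H.closed_sub (isClosed_le (by fun_prop) (by fun_prop))).measurableSet) ?_
      refine Eventually.of_forall fun x => ?_
      by_cases hx : x ∈ E
      · by_cases hgx : (g : C(E, ℝ)) ⟨x, hx⟩ = 0
        · refine Eventually.of_forall fun m => ?_
          simp [hx, hgx]; positivity
        · have hp : 0 < |(g : C(E, ℝ)) ⟨x, hx⟩| := abs_pos.2 hgx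
          filter_upwards [(tendsto_one_div_add_atTop_nhds_zero_nat (𝕜 := ℝ)).eventually_lt_const hp] with m hm
          simp [hx, hgx]; simpa using hm
      · refine Eventually.of_forall fun m => ?_
        simp [hx]
    obtain ⟨m, hm⟩ := (ht.eventually_lt_const hy).exists
    filter_upwards [Metric.ball_mem_nhds g (show (0 : ℝ) < 1 / ((m : ℝ) + 1) by positivity)] with g' hg'
    refine lt_of_le_of_lt (measure_mono (image_mono fun x hx => ?_)) hm
    have h1 : dist ((g' : C(E, ℝ)) x) ((g : C(E, ℝ)) x) ≤ dist (g' : C(E, ℝ)) (g : C(E, ℝ)) :=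
      ContinuousMap.dist_apply_le_dist x
    have h2 : dist (g' : C(E, ℝ)) (g : C(E, ℝ)) < 1 / ((m : ℝ) + 1) := hg'
    have h3 : (g' : C(E, ℝ)) x = 0 := hx
    rw [h3, dist_comm, Real.dist_eq, sub_zero] at h1
    exact h1.trans h2.le
  have hne : (sphere (0 : quadW E) 1).Nonempty := by
    refine ⟨(‖(⟨g, hg⟩ : quadW E)‖)⁻¹ • ⟨g, hg⟩, ?_⟩
    have : (⟨g, hg⟩ : quadW E) ≠ 0 := fun h => hg0 (congrArg Subtype.val h)
    rw [mem_sphere_zero_iff_norm]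
    exact norm_smul_inv_norm (𝕜 := ℝ) this
  have : ProperSpace (quadW E) := FiniteDimensional.proper ℝ _
  obtain ⟨g₀, hg₀, hmax⟩ := UpperSemicontinuousOn.exists_isMaxOn hne (isCompact_sphere (0 : quadW E) 1)
    (husc.upperSemicontinuousOn _)
  have hg₀0 : (g₀ : C(E, ℝ)) ≠ 0 := by
    intro h
    have : g₀ = 0 := Subtype.ext h
    rw [this] at hg₀; simp at hg₀
  have hall : ∀ g : quadW E, g ≠ 0 → F g ≤ F g₀ := by
    intro g hg
    have h1 : (‖g‖)⁻¹ • g ∈ sphere (0 : quadW E) 1 := by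
      rw [mem_sphere_zero_iff_norm]; exact norm_smul_inv_norm (𝕜 := ℝ) hg
    refine le_trans (le_of_eq ?_) (hmax h1)
    have : ‖g‖ ≠ 0 := norm_ne_zero_iff.2 hg
    simp only [F]
    congr 2
    ext x
    simp [hg]
  obtain ⟨x, hx⟩ : ∃ x, (g₀ : C(E, ℝ)) x ≠ 0 := by
    by_contra hcon
    push Not at hcon
    exact hg₀0 (ContinuousMap.ext hcon)
  have hz := H.zero_one (fun B => ∃ g ∈ quadW E, g ≠ 0 ∧ ∀ x : E, (x : EuclideanSpace ℝ (Fin n)) ∈ B ↔ g x = 0)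
    (M := F g₀) (fun B ⟨g, hg, hg0, hB⟩ => ?_) (fun B i ⟨g, hg, hg0, hB⟩ => ?_)
    (B₀ := Subtype.val '' {x : E | (g₀ : C(E, ℝ)) x = 0}) ⟨g₀, g₀.2, hg₀0, fun x => by simp⟩ rfl x.2 ?_
  · refine le_antisymm ?_ zero_le
    rw [← hz]
    exact hall ⟨g, hg⟩ (fun h => hg0 (congrArg Subtype.val h))
  · refine le_trans ?_ (hall ⟨g, hg⟩ (fun h => hg0 (congrArg Subtype.val h)))
    calc μ B ≤ μ (Subtype.val '' {x : E | g x = 0} ∪ Eᶜ) := by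
          refine measure_mono fun x hx => ?_
          by_cases hxE : x ∈ E
          · left; exact ⟨⟨x, hxE⟩, (hB ⟨x, hxE⟩).1 hx, rfl⟩
          · right; exact hxE
      _ ≤ _ := (measure_union_le _ _).trans (by rw [H.null_compl, add_zero])
  · obtain ⟨h1, h2⟩ := H.comp_mem i g hg hg0
    exact ⟨_, h1, h2, fun x => hB ⟨f i x, H.fmem i x.2⟩⟩
  · refine (H.closed_sub (isClosed_eq (by fun_prop) (by fun_prop))).isOpen_compl.mem_nhds ?_
    simpa using hx

lemma sphere_null (H : Setup f rr E s c ρ μ) {x} (hx : x ∈ E) {d : ℝ} (hd : 0 < d) :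
    μ (sphere x d) = 0 := by
  have h := H.quad_null (sqd E x - (d ^ 2) • (1 : C(E, ℝ))) (Submodule.sub_mem _
    (Submodule.subset_span (Or.inr ⟨x, rfl⟩))
    (Submodule.smul_mem _ _ (Submodule.subset_span (Or.inl rfl)))) (fun h => by
      have := congrArg (fun g : C(E, ℝ) => g ⟨x, hx⟩) h
      simp [sqd] at this
      exact hd.ne' this)
  have h2 : sphere x d ⊆ Subtype.val '' {y : E | (sqd E x - (d ^ 2) • (1 : C(E, ℝ))) y = 0} ∪ Eᶜ := by
    intro y hy
    by_cases hyE : y ∈ E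
    · left; refine ⟨⟨y, hyE⟩, ?_, rfl⟩
      rw [mem_sphere] at hy
      simp [sqd, hy]
    · right; exact hyE
  exact measure_mono_null h2 (measure_union_null h H.null_compl)

lemma dens_cont (H : Setup f rr E s c ρ μ) {x} (hx : x ∈ E) {d : ℝ} (hd : 0 < d) :
    ContinuousAt (fun q : EuclideanSpace ℝ (Fin n) × ℝ => densityh μ s q.1 q.2) (x, d) := by
  have := H.hμ
  unfold densityh
  refine ENNReal.Tendsto.div ?_ (Or.inr (H.pos_of_nhds hx (closedBall_mem_nhds x hd))) ?_
    (Or.inr (by simp))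
  · refine (ENNReal.continuous_ofReal.tendsto _).comp ?_
    have : Continuous fun q : EuclideanSpace ℝ (Fin n) × ℝ => 2 * q.2 := by fun_prop
    exact (this.tendsto (x, d)).rpow_const (Or.inr H.hs.le)
  · refine tendsto_measure_of_ae_tendsto_indicator_of_isFiniteMeasure _
      isClosed_closedBall.measurableSet (fun q => isClosed_closedBall.measurableSet) ?_
    have h0 : ∀ᵐ y ∂μ, y ∉ sphere x d := measure_eq_zero_iff_ae_notMem.1 (H.sphere_null hx hd)
    filter_upwards [h0] with y hy
    have hc1 : Continuous fun q : EuclideanSpace ℝ (Fin n) × ℝ => dist y q.1 := by fun_prop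
    have hc2 : Continuous fun q : EuclideanSpace ℝ (Fin n) × ℝ => q.2 := by fun_prop
    rw [mem_sphere] at hy
    rcases lt_or_gt_of_ne hy with h | h
    · filter_upwards [(hc1.tendsto (x, d)).eventually_lt (hc2.tendsto (x, d)) h] with q hq
      simp only [mem_closedBall]
      exact iff_of_true hq.le h.le
    · filter_upwards [(hc2.tendsto (x, d)).eventually_lt (hc1.tendsto (x, d)) h] with q hq
      simp only [mem_closedBall]
      exact iff_of_false (not_le.2 hq) (not_le.2 h)


/-- the maximum of the density over the half-open range is attained -/
lemma exists_max (H : Setup f rr E s c ρ μ) {a rmin : ℝ} (ha : 0 < a) (i₀ : Fin N)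
    (hi₀ : rr i₀ = rmin) (hac : a * rmin ≤ c) :
    ∃ x₀ ∈ E, ∃ d₀, a * rmin ≤ d₀ ∧ d₀ < a ∧ ∀ x ∈ E, ∀ d, a * rmin ≤ d → d < a →
      densityh μ s x d ≤ densityh μ s x₀ d₀ := by
  have hm0 : 0 < rmin := hi₀ ▸ H.hr i₀
  have hm1 : rmin < 1 := hi₀ ▸ (H.hrρ i₀).trans_lt H.hρ1
  have ham : 0 < a * rmin := mul_pos ha hm0
  have ham1 : a * rmin < a := by nlinarith
  have hK : IsCompact (E ×ˢ Icc (a * rmin) a) := H.hEcp.prod isCompact_Icc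
  obtain ⟨x₁, hx₁⟩ := H.hEne
  obtain ⟨⟨x, d⟩, ⟨hx, hd⟩, hmax⟩ := hK.exists_isMaxOn ⟨(x₁, a), hx₁, ham1.le, le_rfl⟩
    (f := fun q : EuclideanSpace ℝ (Fin n) × ℝ => densityh μ s q.1 q.2)
    (fun q hq => (H.dens_cont hq.1 (ham.trans_le hq.2.1)).continuousWithinAt)
  simp only at hx hd
  have hmax' : ∀ y ∈ E, ∀ d', a * rmin ≤ d' → d' < a → densityh μ s y d' ≤ densityh μ s x d :=
    fun y hy d' h1 h2 => hmax (show (y, d') ∈ E ×ˢ Icc (a * rmin) a from ⟨hy, h1, h2.le⟩)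
  rcases lt_or_eq_of_le hd.2 with hlt | rfl
  · exact ⟨x, hx, d, hd.1, hlt, hmax'⟩
  · have hEq : densityh μ s (f i₀ x) (d * rmin) = densityh μ s x d := by
      have h1 : Tendsto (fun t : ℝ => densityh μ s x t) (𝓝[<] d) (𝓝 (densityh μ s x d)) := by
        have h := (H.dens_cont hx ha).tendsto.comp
          ((by fun_prop : Continuous fun t : ℝ => (x, t)).tendsto d)
        exact h.mono_left nhdsWithin_le_nhds
      have h2 : Tendsto (fun t : ℝ => densityh μ s (f i₀ x) (t * rmin)) (𝓝[<] d)
          (𝓝 (densityh μ s (f i₀ x) (d * rmin))) := by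
        have h := (H.dens_cont (H.fmem i₀ hx) ham).tendsto.comp
          ((by fun_prop : Continuous fun t : ℝ => (f i₀ x, t * rmin)).tendsto d)
        exact h.mono_left nhdsWithin_le_nhds
      refine tendsto_nhds_unique_of_eventuallyEq h2 h1 ?_
      filter_upwards [Ioo_mem_nhdsLT ha] with t ht
      rw [mul_comm, ← hi₀]
      refine H.dens_scale hx ht.1 i₀ ?_
      rw [hi₀]
      nlinarith [ht.2]
    exact ⟨f i₀ x, H.fmem i₀ hx, d * rmin, le_rfl, ham1, fun y hy d' h1 h2 => hEq ▸ hmax' y hy d' h1 h2⟩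

lemma le_all (H : Setup f rr E s c ρ μ) {a rmin : ℝ} (ha : 0 < a) (hm0 : 0 < rmin)
    (hmin : ∀ i, rmin ≤ rr i) (hac : a * rmin ≤ c) {θ : ℝ≥0∞}
    (hθ : ∀ x ∈ E, ∀ d, a * rmin ≤ d → d < a → densityh μ s x d ≤ θ) {x} (hx : x ∈ E) {d : ℝ}
    (hd : 0 < d) (hda : d < a) : densityh μ s x d ≤ θ := by
  have key : ∀ k : ℕ, ∀ x ∈ E, ∀ d, a * rmin * ρ ^ k ≤ d → d < a → densityh μ s x d ≤ θ := by
    intro k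
    induction k with
    | zero => intro x hx d h1 h2; exact hθ x hx d (by simpa using h1) h2
    | succ k ih =>
      intro x hx d h1 h2
      by_cases hd : a * rmin ≤ d
      · exact hθ x hx d hd h2
      push Not at hd
      obtain ⟨i, y, hy, rfl⟩ := H.exi hx
      have hri := H.hr i
      have hd0 : 0 < d := lt_of_lt_of_le (by have := H.hρ0; positivity) h1
      have hdd : rr i * (d / rr i) = d := by field_simp
      rw [← hdd, H.dens_scale hy (by positivity) i (by rw [hdd]; linarith)]
      refine ih y hy _ ?_ ?_
      · rw [le_div_iff₀ hri]
        refine le_trans ?_ h1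
        rw [pow_succ, ← mul_assoc]
        have := H.hρ0
        have := H.hrρ i
        gcongr
      · rw [div_lt_iff₀ hri]
        have := hmin i
        nlinarith
  have hp : 0 < d / (a * rmin) := by positivity
  obtain ⟨k, hk⟩ := exists_pow_lt_of_lt_one hp H.hρ1
  refine key k x hx d ?_ hda
  rw [lt_div_iff₀ (by positivity)] at hk
  linarith

lemma nontriv (H : Setup f rr E s c ρ μ) : Nontrivial (EuclideanSpace ℝ (Fin n)) := by
  by_contra h
  rw [not_nontrivial_iff_subsingleton] at h
  have h1 := H.hEdiam
  rw [Metric.diam_subsingleton (Set.subsingleton_of_subsingleton)] at h1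
  exact zero_ne_one h1

lemma mul_meas_le (H : Setup f rr E s c ρ μ) {t : ℝ≥0∞} {x} (hx : x ∈ E) {d : ℝ} (hd : 0 < d)
    (h : t ≤ densityh μ s x d) : t * μ (closedBall x d) ≤ ENNReal.ofReal ((2 * d) ^ s) := by
  have := H.hμ
  unfold densityh at h
  exact (ENNReal.le_div_iff_mul_le (Or.inl (H.pos_of_nhds hx (closedBall_mem_nhds x hd)))
    (Or.inl (measure_ne_top _ _))).1 h

lemma upper (H : Setup f rr E s c ρ μ) {a : ℝ} (ha : 0 < a) {θ : ℝ≥0∞}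
    (hθ : ∀ x ∈ E, ∀ d, 0 < d → d < a → densityh μ s x d ≤ θ) : packM s E ≤ θ := by
  have := H.hμ
  have := H.nontriv
  have hE : packPre0 s E ≤ θ := by
    refine (iInf₂_le a ha).trans ?_
    refine iSup_le fun cen => iSup_le fun rad => iSup_le fun h1 => iSup_le fun h2 => iSup_le fun h3 => ?_
    calc ∑' i, ENNReal.ofReal (Metric.diam (Metric.closedBall (cen i) (rad i)) ^ s)
        ≤ ∑' i, θ * μ (closedBall (cen i) (rad i)) := by
          refine ENNReal.tsum_le_tsum fun i => ?_
          by_cases hr : 0 < rad i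
          · have hdi := Metric.diam_closedBall_eq (cen i) hr.le
            have hlt : rad i < a := by have := h2 i; rw [hdi] at this; linarith
            have h := hθ _ (h1 i) _ hr hlt
            unfold densityh at h
            rw [hdi]
            rwa [ENNReal.div_le_iff_le_mul
              (Or.inl (H.pos_of_nhds (h1 i) (closedBall_mem_nhds _ hr)))
              (Or.inl (measure_ne_top _ _))] at h
          · have : diam (closedBall (cen i) (rad i)) = 0 := by
              refine Metric.diam_subsingleton ?_
              exact Metric.subsingleton_closedBall _ (not_lt.1 hr)
            rw [this, Real.zero_rpow H.hs.ne']; simp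
      _ = θ * μ (⋃ i, closedBall (cen i) (rad i)) := by
          rw [ENNReal.tsum_mul_left, measure_iUnion h3 (fun i => isClosed_closedBall.measurableSet)]
      _ ≤ θ * 1 := by gcongr; exact prob_le_one
      _ = θ := mul_one _
  have hemp : packPre0 s (∅ : Set (EuclideanSpace ℝ (Fin n))) = 0 := by
    refine le_antisymm ?_ zero_le
    refine (iInf₂_le 1 one_pos).trans ?_
    refine iSup_le fun cen => iSup_le fun rad => iSup_le fun h1 => (h1 0).elim
  let U : ℕ → Set (EuclideanSpace ℝ (Fin n)) := fun k => if k = 0 then E else ∅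
  refine (iInf₂_le U (fun x hx => mem_iUnion.2 ⟨0, by simpa [U] using hx⟩)).trans ?_
  rw [tsum_eq_single 0 (fun k hk => by simp [U, hk, hemp])]
  simpa [U] using hE

lemma ae_good (H : Setup f rr E s c ρ μ) {a : ℝ} (ha : 0 < a) {t : ℝ≥0∞}
    (hac : ∀ i, rr i * a ≤ c) {x₀} (hx₀ : x₀ ∈ E) {d₀ : ℝ} (hd₀ : 0 < d₀) (hd₀a : d₀ < a)
    (ht : t < densityh μ s x₀ d₀) :
    μ {x | x ∈ E ∧ ∀ δ > 0, ∃ d, 0 < d ∧ d < δ ∧ t ≤ densityh μ s x d}ᶜ = 0 := by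
  let Bad : ℝ → Set (EuclideanSpace ℝ (Fin n)) := fun δ =>
    {x | x ∈ E ∧ ∀ d, 0 < d → d < δ → densityh μ s x d < t}
  have hpre : ∀ i y δ, y ∈ E → δ ≤ a → f i y ∈ Bad (ρ * δ) → y ∈ Bad δ := by
    intro i y δ hy hδ hb
    refine ⟨hy, fun d hd hdδ => ?_⟩
    have hri := H.hr i
    have h := hb.2 (rr i * d) (mul_pos hri hd) ?_
    · rwa [H.dens_scale hy hd i ?_] at h
      have := hac i
      nlinarith
    · have := H.hrρ i
      nlinarith [H.hρ0]
  have hmono : ∀ δ δ', δ ≤ δ' → Bad δ' ⊆ Bad δ := fun δ δ' h x hx =>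
    ⟨hx.1, fun d hd hdδ => hx.2 d hd (hdδ.trans_le h)⟩
  have h0 : μ (Bad a) = 0 := by
    refine H.zero_one (fun B => ∀ x ∈ E, x ∈ B → x ∈ Bad a) (M := μ (Bad a)) (fun B hB => ?_)
      (fun B i hB x hx hxB => ?_) (B₀ := Bad a) (fun x _ h => h) rfl hx₀ ?_
    · calc μ B ≤ μ (Bad a ∪ Eᶜ) := by
            refine measure_mono fun x hx => ?_
            by_cases hxE : x ∈ E
            · left; exact hB x hxE hx
            · right; exact hxE
        _ ≤ _ := (measure_union_le _ _).trans (by rw [H.null_compl, add_zero])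
    · refine hpre i x a hx le_rfl (hmono _ a ?_ (hB _ (H.fmem i hx) hxB))
      nlinarith [H.hρ1]
    · have h := (H.dens_cont hx₀ hd₀).tendsto.comp
          ((by fun_prop : Continuous fun y : EuclideanSpace ℝ (Fin n) => (y, d₀)).tendsto x₀)
      filter_upwards [h.eventually_const_lt ht] with y hy hyB
      exact lt_asymm hy (hyB.2 d₀ hd₀ hd₀a)
  have hk : ∀ k : ℕ, μ (Bad (ρ ^ k * a)) = 0 := by
    intro k
    induction k with
    | zero => simpa using h0
    | succ k ih =>
      rw [H.ss]
      refine Finset.sum_eq_zero fun i _ => ?_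
      have : μ (f i ⁻¹' Bad (ρ ^ (k + 1) * a)) = 0 := by
        refine measure_mono_null (t := Bad (ρ ^ k * a) ∪ Eᶜ) (fun x hx => ?_)
          (measure_union_null ih H.null_compl)
        by_cases hxE : x ∈ E
        · left
          refine hpre i x _ hxE ?_ ?_
          · exact mul_le_of_le_one_left ha.le (pow_le_one₀ H.hρ0.le H.hρ1.le)
          · rw [mem_preimage, pow_succ', mul_assoc] at hx
            exact hx
        · right; exact hxE
      rw [this, mul_zero]
  refine measure_mono_null (t := (⋃ k : ℕ, Bad (ρ ^ k * a)) ∪ Eᶜ) (fun x hx => ?_)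
    (measure_union_null (measure_iUnion_null hk) H.null_compl)
  by_cases hxE : x ∈ E
  · left
    have : ∃ δ > 0, ∀ d, 0 < d → d < δ → densityh μ s x d < t := by
      by_contra hcon
      push Not at hcon
      exact hx ⟨hxE, hcon⟩
    obtain ⟨δ, hδ, hb⟩ := this
    obtain ⟨k, hk⟩ := exists_pow_lt_of_lt_one (div_pos hδ ha) H.hρ1
    rw [lt_div_iff₀ ha] at hk
    exact mem_iUnion.2 ⟨k, hxE, fun d hd hdk => hb d hd (hdk.trans hk)⟩
  · right; exact hxE

lemma lower_pre (H : Setup f rr E s c ρ μ) {t : ℝ≥0∞}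
    (hae : μ {x | x ∈ E ∧ ∀ δ > 0, ∃ d, 0 < d ∧ d < δ ∧ t ≤ densityh μ s x d}ᶜ = 0)
    (U : Set (EuclideanSpace ℝ (Fin n))) : t * μ U ≤ packPre0 s U := by
  have := H.hμ
  have := H.nontriv
  refine le_iInf₂ fun δ hδ => ?_
  set G := {x | x ∈ E ∧ ∀ δ > 0, ∃ d, 0 < d ∧ d < δ ∧ t ≤ densityh μ s x d} with hG
  obtain ⟨T, r, hTc, hTs, hTr, hTn, hTd⟩ := Besicovitch.exists_disjoint_closedBall_covering_ae μ
    (fun x => {d | t ≤ densityh μ s x d}) (U ∩ G)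
    (fun x hx δ hδ => by
      obtain ⟨d, h1, h2, h3⟩ := hx.2.2 δ hδ
      exact ⟨d, h3, h1, h2⟩) (fun _ => δ / 2) (fun _ _ => by positivity)
  have hU : μ U ≤ ∑' x : T, μ (closedBall (x : EuclideanSpace ℝ (Fin n)) (r x)) := by
    have hsub : U ⊆ ((U ∩ G) \ ⋃ x ∈ T, closedBall x (r x)) ∪ Gᶜ ∪ ⋃ x ∈ T, closedBall x (r x) := by
      intro x hx
      by_cases h1 : x ∈ ⋃ x ∈ T, closedBall x (r x)
      · exact Or.inr h1
      · by_cases h2 : x ∈ G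
        · exact Or.inl (Or.inl ⟨⟨hx, h2⟩, h1⟩)
        · exact Or.inl (Or.inr h2)
    calc μ U ≤ _ := measure_mono hsub
      _ ≤ μ (((U ∩ G) \ ⋃ x ∈ T, closedBall x (r x)) ∪ Gᶜ) + μ (⋃ x ∈ T, closedBall x (r x)) :=
          measure_union_le _ _
      _ = μ (⋃ x ∈ T, closedBall x (r x)) := by
          rw [measure_union_null hTn hae, zero_add]
      _ ≤ _ := measure_biUnion_le μ hTc _
  rcases T.eq_empty_or_nonempty with rfl | ⟨z, hz⟩
  · have : μ U = 0 := le_antisymm (by simpa using hU) zero_le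
    rw [this, mul_zero]; exact zero_le
  have hcT : Countable T := hTc.to_subtype
  let _ : Encodable T := Encodable.ofCountable T
  let cen : ℕ → EuclideanSpace ℝ (Fin n) := fun k =>
    ((Encodable.decode₂ T k).getD ⟨z, hz⟩ : T)
  let rad : ℕ → ℝ := fun k => ((Encodable.decode₂ T k).map fun x : T => r x).getD (-1)
  have hcase : ∀ k, (rad k < 0) ∨ ∃ x : T, Encodable.encode x = k ∧ cen k = x ∧ rad k = r x := by
    intro k
    rcases h : Encodable.decode₂ T k with _ | x
    · left; simp [rad, h]
    · right; exact ⟨x, Encodable.decode₂_eq_some.1 h, by simp [cen, h], by simp [rad, h]⟩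
  have hcen : ∀ x : T, cen (Encodable.encode x) = x := fun x => by simp [cen]
  have hrad : ∀ x : T, rad (Encodable.encode x) = r x := fun x => by simp [rad]
  have hpk : ∑' i, ENNReal.ofReal (Metric.diam (Metric.closedBall (cen i) (rad i)) ^ s)
      ≤ packPre s δ U := by
    unfold packPre
    refine le_iSup_of_le cen (le_iSup_of_le rad (le_iSup_of_le ?_ (le_iSup_of_le ?_
      (le_iSup_of_le ?_ le_rfl))))
    · intro k
      exact (hTs ((Encodable.decode₂ T k).getD ⟨z, hz⟩).2).1
    · intro k
      rcases hcase k with h | ⟨x, -, h1, h2⟩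
      · rw [closedBall_eq_empty.2 h]; simpa using hδ.le
      · have := (hTr x x.2).2
        rw [h1, h2, Metric.diam_closedBall_eq _ this.1.le]
        have := this.2
        linarith
    · intro k l hkl
      rcases hcase k with h | ⟨x, hx, h1, h2⟩
      · simp only [closedBall_eq_empty.2 h, empty_disjoint]
      rcases hcase l with h | ⟨y, hy, h3, h4⟩
      · simp only [closedBall_eq_empty.2 h, disjoint_empty]
      simp only [h1, h2, h3, h4]
      refine hTd x.2 y.2 fun hxy => hkl ?_
      rw [← hx, ← hy, Subtype.ext hxy]
  refine le_trans ?_ hpk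
  refine le_trans ?_ (ENNReal.tsum_comp_le_tsum_of_injective
    (Encodable.encode_injective (α := T)) _)
  calc t * μ U ≤ t * ∑' x : T, μ (closedBall (x : EuclideanSpace ℝ (Fin n)) (r x)) := by gcongr
    _ = ∑' x : T, t * μ (closedBall (x : EuclideanSpace ℝ (Fin n)) (r x)) := ENNReal.tsum_mul_left.symm
    _ ≤ _ := ENNReal.tsum_le_tsum fun x => by
        have h := hTr x x.2
        rw [hcen, hrad, Metric.diam_closedBall_eq _ h.2.1.le]
        exact H.mul_meas_le (hTs x.2).2.1 h.2.1 h.1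

lemma lower (H : Setup f rr E s c ρ μ) {t : ℝ≥0∞}
    (hae : μ {x | x ∈ E ∧ ∀ δ > 0, ∃ d, 0 < d ∧ d < δ ∧ t ≤ densityh μ s x d}ᶜ = 0) :
    t ≤ packM s E := by
  refine le_iInf₂ fun U hU => ?_
  calc t = t * μ E := by rw [H.meas_E, mul_one]
    _ ≤ t * ∑' i, μ (U i) := by gcongr; exact (measure_mono hU).trans (measure_iUnion_le _)
    _ = ∑' i, t * μ (U i) := ENNReal.tsum_mul_left.symm
    _ ≤ _ := ENNReal.tsum_le_tsum fun i => H.lower_pre hae (U i)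

end Setup

end Aux

theorem packing_measure_attained_on_halfopen_range
{n N : ℕ} (hN : 2 ≤ N)
    (f : Fin N → EuclideanSpace ℝ (Fin n) → EuclideanSpace ℝ (Fin n))
    (rr : Fin N → ℝ) (hr : ∀ i, 0 < rr i ∧ rr i < 1)
    (hsim : ∀ i x y, dist (f i x) (f i y) = rr i * dist x y)
    (E : Set (EuclideanSpace ℝ (Fin n))) (hEne : E.Nonempty) (hEcp : IsCompact E)
    (hEinv : E = ⋃ i, f i '' E)
    (hssc : ∀ i j, i ≠ j → Disjoint (f i '' E) (f j '' E))
(hEdiam : Metric.diam E = 1)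
(rmin : ℝ) (hrmin : IsLeast (Set.range rr) rmin)
(c : ℝ) (hc : 0 < c)
    (hcdef : c = sInf {d : ℝ | ∃ i j : Fin N, i ≠ j ∧
      ∃ u ∈ f i '' E, ∃ v ∈ f j '' E, d = dist u v})
(s : ℝ) (hs : 0 < s) (hsum : ∑ i, rr i ^ s = 1)
    (μ : MeasureTheory.Measure (EuclideanSpace ℝ (Fin n))) (hμ : IsProbabilityMeasure μ)
    (hμss : ∀ A : Set (EuclideanSpace ℝ (Fin n)), MeasurableSet A →
      μ A = ∑ i, ENNReal.ofReal (rr i ^ s) * μ (f i ⁻¹' A))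
    (a : ℝ) (ha : 0 < a) (ha' : a ≤ c / rmin) :
    IsGreatest {v : ℝ≥0∞ | ∃ x ∈ E, ∃ d : ℝ, a * rmin ≤ d ∧ d < a ∧ v = densityh μ s x d}
      (packM s E) := by
  obtain ⟨⟨i₀, hi₀⟩, hmin⟩ := hrmin
  have hmin' : ∀ i, rmin ≤ rr i := fun i => hmin ⟨i, rfl⟩
  have hm0 : 0 < rmin := hi₀ ▸ (hr i₀).1
  have hne : (Finset.univ : Finset (Fin N)).Nonempty := ⟨i₀, Finset.mem_univ _⟩
  obtain ⟨i₁, -, hi₁⟩ := Finset.exists_max_image Finset.univ rr hne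
  have H : Setup f rr E s c (rr i₁) μ :=
    { hr := fun i => (hr i).1
      hρ0 := (hr i₁).1
      hρ1 := (hr i₁).2
      hrρ := fun i => hi₁ i (Finset.mem_univ i)
      hsim := hsim
      hEne := hEne
      hEcp := hEcp
      hEinv := hEinv
      hEdiam := hEdiam
      hsep := fun i j hij u hu v hv => by
        rw [hcdef]
        refine csInf_le ⟨0, ?_⟩ ⟨i, j, hij, f i u, ⟨u, hu, rfl⟩, f j v, ⟨v, hv, rfl⟩, rfl⟩
        rintro d ⟨i, j, -, u, -, v, -, rfl⟩
        exact dist_nonneg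
      hs := hs
      hsum := hsum
      hμ := hμ
      hμss := hμss }
  have hac : a * rmin ≤ c := (le_div_iff₀ hm0).1 ha'
  obtain ⟨x₀, hx₀, d₀, h1, h2, hmax⟩ := H.exists_max ha i₀ hi₀ hac
  have hd₀ : 0 < d₀ := lt_of_lt_of_le (by positivity) h1
  have hle : ∀ x ∈ E, ∀ d, 0 < d → d < a → densityh μ s x d ≤ densityh μ s x₀ d₀ :=
    fun x hx d hd hda => H.le_all ha hm0 hmin' hac hmax hx hd hda
  have hup := H.upper ha hle
  have hlo : densityh μ s x₀ d₀ ≤ packM s E := by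
    have hsc : densityh μ s (f i₀ x₀) (rr i₀ * d₀) = densityh μ s x₀ d₀ :=
      H.dens_scale hx₀ hd₀ i₀ (by rw [hi₀]; nlinarith)
    refine le_of_forall_lt_imp_le_of_dense fun t ht => ?_
    rw [← hsc] at ht
    refine H.lower (H.ae_good (a := a * rmin) (by positivity) (fun i => ?_) (H.fmem i₀ hx₀)
      (mul_pos (hr i₀).1 hd₀) (by rw [hi₀]; nlinarith) ht)
    have := (hr i).2
    have : 0 < a * rmin := by positivity
    nlinarith
  have heq := le_antisymm hup hlo
  refine ⟨⟨x₀, hx₀, d₀, h1, h2, heq⟩, ?_⟩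
  rintro v ⟨x, hx, d, hd1, hd2, rfl⟩
  rw [heq]
  exact hmax x hx d hd1 hd2
end

section
/- For every a ∈ (0, c/r_min] there exists a pair (x_0, d_0) ∈ E × [a·r_min, a) such that P^s(E) = h(x_0, d_0) and ∂B(x_0, d_0) ∩ E ≠ ∅; consequently there exists y ∈ E with d_0 = dist(x_0, y), so that P^s(E) = (2·dist(x_0,y))^s / μ(B(x_0, dist(x_0,y))). -/
open Metric Set MeasureTheory Filter Topology
open scoped ENNReal NNReal

namespace PackAux

structure Sys {n N : ℕ} (f : Fin N → EuclideanSpace ℝ (Fin n) → EuclideanSpace ℝ (Fin n))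
    (rr : Fin N → ℝ) (E : Set (EuclideanSpace ℝ (Fin n))) (rmin rmax c s : ℝ)
    (μ : Measure (EuclideanSpace ℝ (Fin n))) : Prop where
  pos : ∀ i, 0 < rr i
  sim : ∀ i x y, dist (f i x) (f i y) = rr i * dist x y
  ne : E.Nonempty
  cp : IsCompact E
  inv : ∀ x, x ∈ E ↔ ∃ i, ∃ y ∈ E, f i y = x
  dle : ∀ x ∈ E, ∀ y ∈ E, dist x y ≤ 1
  min_le : ∀ i, rmin ≤ rr i
  min_pos : 0 < rmin
  ex_min : ∃ i, rr i = rmin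
  le_max : ∀ i, rr i ≤ rmax
  max_pos : 0 < rmax
  max_lt : rmax < 1
  cpos : 0 < c
  sep : ∀ i j, i ≠ j → ∀ x ∈ E, ∀ y ∈ E, c ≤ dist (f i x) (f j y)
  spos : 0 < s
  sum : ∑ i, rr i ^ s = 1
  prob : IsProbabilityMeasure μ
  ss : ∀ A : Set (EuclideanSpace ℝ (Fin n)), MeasurableSet A →
      μ.real A = ∑ i, rr i ^ s * μ.real (f i ⁻¹' A)

namespace Sys

variable {n N : ℕ} {f : Fin N → EuclideanSpace ℝ (Fin n) → EuclideanSpace ℝ (Fin n)}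
    {rr : Fin N → ℝ} {E : Set (EuclideanSpace ℝ (Fin n))} {rmin rmax c s : ℝ}
    {μ : Measure (EuclideanSpace ℝ (Fin n))}

lemma mapE (S : Sys f rr E rmin rmax c s μ) (i : Fin N) {x} (hx : x ∈ E) : f i x ∈ E :=
  (S.inv _).2 ⟨i, x, hx, rfl⟩

lemma cont (S : Sys f rr E rmin rmax c s μ) (i : Fin N) : Continuous (f i) := by
  have : LipschitzWith (Real.toNNReal (rr i)) (f i) := by
    apply LipschitzWith.of_dist_le_mul
    intro x y
    rw [S.sim, Real.coe_toNNReal _ (S.pos i).le]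
  exact this.continuous

lemma wpos (S : Sys f rr E rmin rmax c s μ) (i : Fin N) : 0 < rr i ^ s :=
  Real.rpow_pos_of_pos (S.pos i) s

/-- averaging upper bound -/
lemma avg_le (S : Sys f rr E rmin rmax c s μ) {b : Fin N → ℝ} {M : ℝ} (h : ∀ i, b i ≤ M) :
    ∑ i, rr i ^ s * b i ≤ M := by
  calc ∑ i, rr i ^ s * b i ≤ ∑ i, rr i ^ s * M :=
        Finset.sum_le_sum fun i _ => mul_le_mul_of_nonneg_left (h i) (S.wpos i).le
    _ = M := by rw [← Finset.sum_mul, S.sum, one_mul]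

lemma avg_ge (S : Sys f rr E rmin rmax c s μ) {b : Fin N → ℝ} {M : ℝ} (h : ∀ i, M ≤ b i) :
    M ≤ ∑ i, rr i ^ s * b i := by
  calc M = ∑ i, rr i ^ s * M := by rw [← Finset.sum_mul, S.sum, one_mul]
    _ ≤ _ := Finset.sum_le_sum fun i _ => mul_le_mul_of_nonneg_left (h i) (S.wpos i).le

lemma avg_eq (S : Sys f rr E rmin rmax c s μ) {b : Fin N → ℝ} {M : ℝ} (h : ∀ i, b i ≤ M)
    (he : M = ∑ i, rr i ^ s * b i) (i : Fin N) : b i = M := by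
  by_contra hne
  have hlt : b i < M := lt_of_le_of_ne (h i) hne
  have : ∑ i, rr i ^ s * b i < ∑ i, rr i ^ s * M :=
    Finset.sum_lt_sum (fun i _ => mul_le_mul_of_nonneg_left (h i) (S.wpos i).le)
      ⟨i, Finset.mem_univ _, mul_lt_mul_of_pos_left hlt (S.wpos i)⟩
  rw [← Finset.sum_mul, S.sum, one_mul, ← he] at this
  exact lt_irrefl _ this

/-- thickening estimate -/
lemma thick (S : Sys f rr E rmin rmax c s μ) (ρ : ℝ) (k : ℕ) :
    μ.real (cthickening ρ E) ≤ μ.real (cthickening (rmax ^ k * ρ) E) := by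
  have := S.prob
  induction k with
  | zero => simp
  | succ k ih =>
    refine ih.trans ?_
    rw [S.ss (cthickening (rmax ^ (k+1) * ρ) E) isClosed_cthickening.measurableSet]
    apply S.avg_ge
    intro i
    rcases le_or_gt 0 ρ with hρ | hρ
    · refine measureReal_mono ?_ (by finiteness)
      intro x hx
      rw [S.cp.cthickening_eq_biUnion_closedBall (by have := S.max_pos; positivity)] at hx
      simp only [mem_iUnion, Metric.mem_closedBall] at hx
      obtain ⟨y, hy, hd⟩ := hx
      apply mem_cthickening_of_dist_le (f i x) (f i y) _ _ (S.mapE i hy)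
      rw [S.sim, pow_succ']
      have h1 := S.le_max i
      have h2 := S.pos i
      rw [mul_assoc]
      exact mul_le_mul h1 hd dist_nonneg S.max_pos.le
    · have h1 : rmax ^ k * ρ ≤ 0 := by have := pow_pos S.max_pos k; nlinarith
      have h2 : rmax ^ (k+1) * ρ ≤ 0 := by have := pow_pos S.max_pos (k+1); nlinarith
      rw [cthickening_of_nonpos h1, cthickening_of_nonpos h2]
      refine measureReal_mono ?_ (by finiteness)
      rw [S.cp.isClosed.closure_eq]
      intro x hx
      exact S.mapE i hx

lemma real_E (S : Sys f rr E rmin rmax c s μ) : μ.real E = 1 := by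
  have := S.prob
  have h1 : ∀ ρ : ℝ, μ (cthickening ρ E) ≤ μ E := by
    intro ρ
    have ht : Tendsto (fun k : ℕ => rmax ^ k * ρ) atTop (𝓝 0) := by
      have := (tendsto_pow_atTop_nhds_zero_of_lt_one S.max_pos.le S.max_lt).mul_const ρ
      simpa using this
    have h2 : Tendsto (fun k : ℕ => μ (cthickening (rmax ^ k * ρ) E)) atTop (𝓝 (μ E)) :=
      (tendsto_measure_cthickening_of_isClosed ⟨1, one_pos, by finiteness⟩ S.cp.isClosed).comp ht
    refine ge_of_tendsto' h2 fun k => ?_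
    have := S.thick ρ k
    exact (ENNReal.toReal_le_toReal (by finiteness) (by finiteness)).1 this
  have h3 : (univ : Set (EuclideanSpace ℝ (Fin n))) = ⋃ k : ℕ, cthickening (k : ℝ) E := by
    symm
    rw [eq_univ_iff_forall]
    intro x
    obtain ⟨y, hy⟩ := S.ne
    obtain ⟨k, hk⟩ := exists_nat_ge (dist x y)
    exact mem_iUnion.2 ⟨k, mem_cthickening_of_dist_le x y _ _ hy hk⟩
  have hmono : Monotone fun k : ℕ => cthickening (k : ℝ) E := fun a b hab =>
    cthickening_mono (by exact_mod_cast hab) E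
  have h4 : μ univ ≤ μ E := by
    rw [h3, hmono.measure_iUnion]
    exact iSup_le fun k => h1 k
  have h5 : μ E = 1 := le_antisymm prob_le_one (by simpa using h4)
  simp [Measure.real, h5]

lemma null_compl (S : Sys f rr E rmin rmax c s μ) : μ Eᶜ = 0 := by
  have := S.prob
  rw [prob_compl_eq_zero_iff S.cp.isClosed.measurableSet]
  have := S.real_E
  rw [Measure.real] at this
  rw [← ENNReal.ofReal_toReal (measure_ne_top μ E), this, ENNReal.ofReal_one]

/-- monotonicity modulo the complement of `E` -/
lemma mono_E (S : Sys f rr E rmin rmax c s μ) {A B : Set (EuclideanSpace ℝ (Fin n))}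
    (h : ∀ x ∈ A, x ∈ E → x ∈ B) : μ.real A ≤ μ.real B := by
  have := S.prob
  apply ENNReal.toReal_mono (by finiteness)
  apply measure_mono_ae
  have : ∀ᵐ x ∂μ, x ∈ E := by
    rw [ae_iff]; exact S.null_compl
  filter_upwards [this] with x hx hA
  exact h x hA hx

lemma real_zero (S : Sys f rr E rmin rmax c s μ) {A : Set (EuclideanSpace ℝ (Fin n))}
    (h : ∀ x ∈ A, x ∉ E) : μ.real A = 0 := by
  have := S.mono_E (A := A) (B := ∅) (fun x hx hE => (h x hx hE).elim)
  simp only [measureReal_empty] at this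
  exact le_antisymm this measureReal_nonneg

lemma ss_one (S : Sys f rr E rmin rmax c s μ) {A : Set (EuclideanSpace ℝ (Fin n))}
    (hA : MeasurableSet A) (i : Fin N) (h : ∀ j, j ≠ i → ∀ x ∈ E, f j x ∉ A) :
    μ.real A = rr i ^ s * μ.real (f i ⁻¹' A) := by
  rw [S.ss A hA, Finset.sum_eq_single i]
  · intro j _ hj
    rw [S.real_zero (A := f j ⁻¹' A) (fun x hx hE => h j hj x hE hx), mul_zero]
  · simp

lemma inj (S : Sys f rr E rmin rmax c s μ) (i : Fin N) : Function.Injective (f i) := by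
  intro x y h
  have := S.sim i x y
  rw [h, dist_self] at this
  have h2 := S.pos i
  exact dist_eq_zero.1 ((mul_eq_zero.1 this.symm).resolve_left h2.ne')

lemma atom_le (S : Sys f rr E rmin rmax c s μ) (k : ℕ) :
    ∀ x, μ.real {x} ≤ (rmax ^ s) ^ k := by
  have := S.prob
  have hm : 0 ≤ rmax ^ s := (Real.rpow_pos_of_pos S.max_pos s).le
  induction k with
  | zero => intro x; simp
  | succ k ih =>
    intro x
    by_cases hx : x ∈ E
    · obtain ⟨i, y, hy, rfl⟩ := (S.inv x).1 hx
      rw [S.ss_one (measurableSet_singleton _) i]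
      · have : f i ⁻¹' {f i y} = {y} := by
          ext z; simp [(S.inj i).eq_iff]
        rw [this, pow_succ']
        exact mul_le_mul (Real.rpow_le_rpow (S.pos i).le (S.le_max i) S.spos.le) (ih y)
          measureReal_nonneg hm
      · intro j hj z hz h
        have h1 := S.sep j i hj z hz y hy
        rw [mem_singleton_iff.1 h, dist_self] at h1
        exact absurd S.cpos (not_lt.2 h1)
    · rw [S.real_zero (by rintro z rfl; exact hx)]
      positivity

lemma noAtoms (S : Sys f rr E rmin rmax c s μ) : NullSingletonClass μ := by
  have := S.prob
  constructor
  intro x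
  rw [← measureReal_eq_zero_iff]
  refine le_antisymm ?_ measureReal_nonneg
  refine ge_of_tendsto' (tendsto_pow_atTop_nhds_zero_of_lt_one (r := rmax ^ s) ?_ ?_)
    fun k => S.atom_le k x
  · exact (Real.rpow_pos_of_pos S.max_pos s).le
  · exact Real.rpow_lt_one S.max_pos.le S.max_lt S.spos

/-- the similitude as an affine equivalence -/
lemma exists_affine (S : Sys f rr E rmin rmax c s μ) (i : Fin N) :
    ∃ e : EuclideanSpace ℝ (Fin n) ≃ᵃ[ℝ] EuclideanSpace ℝ (Fin n), ∀ x, e x = f i x := by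
  have hp := S.pos i
  have hiso : Isometry (fun x => (rr i)⁻¹ • f i x) := by
    apply Isometry.of_dist_eq
    intro x y
    rw [dist_smul₀, S.sim, Real.norm_eq_abs, abs_of_pos (inv_pos.2 hp)]
    field_simp
  let F : EuclideanSpace ℝ (Fin n) →ᵃ[ℝ] EuclideanSpace ℝ (Fin n) :=
    (rr i) • hiso.affineIsometryOfStrictConvexSpace.toAffineMap
  have hF : ∀ x, F x = f i x := by
    intro x
    simp [F, smul_smul, hp.ne']
  have hinj : Function.Injective F := by
    intro x y h
    rw [hF, hF] at h
    exact S.inj i h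
  have hsurj : Function.Surjective F := by
    rw [← AffineMap.linear_surjective_iff]
    apply LinearMap.surjective_of_injective
    rwa [AffineMap.linear_injective_iff]
  exact ⟨AffineEquiv.ofBijective ⟨hinj, hsurj⟩, hF⟩

/-- intersections of a `k`-dimensional affine subspace with a sphere -/
def fam (n k : ℕ) : Set (Set (EuclideanSpace ℝ (Fin n))) :=
  {A | ∃ (V : AffineSubspace ℝ (EuclideanSpace ℝ (Fin n))) (x : EuclideanSpace ℝ (Fin n)) (r : ℝ),
    Module.finrank ℝ V.direction = k ∧ A = (V : Set _) ∩ sphere x r}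

lemma fam_closed {k : ℕ} {A} (hA : A ∈ fam n k) : IsClosed A := by
  obtain ⟨V, x, r, -, rfl⟩ := hA
  exact (AffineSubspace.closed_of_finiteDimensional V).inter isClosed_sphere

lemma fam_bdd {k : ℕ} {A} (hA : A ∈ fam n k) : Bornology.IsBounded A := by
  obtain ⟨V, x, r, -, rfl⟩ := hA
  exact isBounded_sphere.subset inter_subset_right

lemma fam_preimage (S : Sys f rr E rmin rmax c s μ) (i : Fin N) {k : ℕ} {A}
    (hA : A ∈ fam n k) : f i ⁻¹' A ∈ fam n k := by
  obtain ⟨V, x, r, hV, rfl⟩ := hA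
  obtain ⟨e, he⟩ := S.exists_affine i
  refine ⟨V.map e.symm.toAffineMap, e.symm x, r / rr i, ?_, ?_⟩
  · rw [AffineSubspace.map_direction, ← hV]
    exact LinearEquiv.finrank_map_eq e.symm.linear V.direction
  · ext y
    have h1 : dist (f i y) x = rr i * dist y (e.symm x) := by
      rw [← S.sim, ← he (e.symm x), e.apply_symm_apply]
    simp only [mem_preimage, mem_inter_iff, mem_sphere, h1]
    rw [eq_div_iff (S.pos i).ne', mul_comm (rr i)]
    apply and_congr_left
    intro _
    simp only [AffineSubspace.coe_map, AffineEquiv.coe_toAffineMap]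
    constructor
    · intro h
      exact ⟨f i y, h, by rw [← he]; exact e.symm_apply_apply y⟩
    · rintro ⟨z, hz, rfl⟩
      rw [← he]
      have : e (e.symm z) = z := e.apply_symm_apply z
      rw [this]; exact hz

/-- distinct members of the minimal family have an intersection in a smaller family -/
lemma fam_inter {k : ℕ} {A B} (hA : A ∈ fam n k) (hB : B ∈ fam n k) (hne : A ≠ B)
    (hn : (A ∩ B).Nonempty) : ∃ k' < k, ∃ C ∈ fam n k', A ∩ B ⊆ C := by
  obtain ⟨V₁, x₁, r₁, h₁, rfl⟩ := hA
  obtain ⟨V₂, x₂, r₂, h₂, rfl⟩ := hB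
  set I := ((V₁ : Set _) ∩ sphere x₁ r₁) ∩ ((V₂ : Set _) ∩ sphere x₂ r₂) with hI
  have hW₁ : affineSpan ℝ I ≤ V₁ := by
    rw [affineSpan_le]; exact fun x hx => hx.1.1
  have hW₂ : affineSpan ℝ I ≤ V₂ := by
    rw [affineSpan_le]; exact fun x hx => hx.2.1
  have hle : Module.finrank ℝ (affineSpan ℝ I).direction ≤ k := by
    rw [← h₁]; exact Submodule.finrank_mono (AffineSubspace.direction_le hW₁)
  have hWne : ((affineSpan ℝ I : AffineSubspace ℝ _) : Set (EuclideanSpace ℝ (Fin n))).Nonempty :=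
    hn.mono (subset_affineSpan ℝ I)
  rcases hle.lt_or_eq with hlt | heq
  · exact ⟨_, hlt, _, ⟨affineSpan ℝ I, x₁, r₁, rfl, rfl⟩,
      fun x hx => ⟨subset_affineSpan ℝ I hx, hx.1.2⟩⟩
  · exfalso
    have e₁ : affineSpan ℝ I = V₁ := AffineSubspace.eq_of_direction_eq_of_nonempty_of_le
      (Submodule.eq_of_le_of_finrank_eq (AffineSubspace.direction_le hW₁) (heq.trans h₁.symm))
      hWne hW₁
    have e₂ : affineSpan ℝ I = V₂ := AffineSubspace.eq_of_direction_eq_of_nonempty_of_le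
      (Submodule.eq_of_le_of_finrank_eq (AffineSubspace.direction_le hW₂) (heq.trans h₂.symm))
      hWne hW₂
    have key : ∀ x ∈ affineSpan ℝ I, dist x x₁ ^ 2 - r₁ ^ 2 = dist x x₂ ^ 2 - r₂ ^ 2 := by
      have conv : ∀ x : EuclideanSpace ℝ (Fin n),
          dist x x₁ ^ 2 - r₁ ^ 2 = dist x x₂ ^ 2 - r₂ ^ 2 ↔
          inner ℝ x (x₂ - x₁) = (‖x₂‖ ^ 2 - ‖x₁‖ ^ 2 - r₂ ^ 2 + r₁ ^ 2) / 2 := by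
        intro x
        rw [dist_eq_norm, dist_eq_norm, norm_sub_sq_real, norm_sub_sq_real, inner_sub_right]
        constructor <;> intro h <;> linarith
      intro x hx
      rw [conv]
      refine affineSpan_induction hx (p := fun x => inner ℝ x (x₂ - x₁) = (‖x₂‖ ^ 2 - ‖x₁‖ ^ 2 - r₂ ^ 2 + r₁ ^ 2) / 2) ?_ ?_
      · intro y hy
        rw [← conv, mem_sphere.1 hy.1.2, mem_sphere.1 hy.2.2]; ring
      · intro t u v w hu hv hw
        simp only [vsub_eq_sub, vadd_eq_add, inner_add_left, inner_smul_left, inner_sub_left] at *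
        rw [hu, hv, hw]; simp
    obtain ⟨z, hz⟩ := hn
    have p₁ : 0 ≤ r₁ := by rw [← mem_sphere.1 hz.1.2]; exact dist_nonneg
    have p₂ : 0 ≤ r₂ := by rw [← mem_sphere.1 hz.2.2]; exact dist_nonneg
    apply hne
    rw [← e₁, ← e₂]
    ext x
    simp only [mem_inter_iff, mem_sphere]
    apply and_congr_right
    intro hx
    have hk := key x hx
    constructor
    · intro h
      rw [h] at hk
      exact (sq_eq_sq₀ dist_nonneg p₂).1 (by linarith)
    · intro h
      rw [h] at hk
      exact (sq_eq_sq₀ dist_nonneg p₁).1 (by linarith)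

lemma fam_null (S : Sys f rr E rmin rmax c s μ) (k : ℕ) : ∀ A ∈ fam n k, μ.real A = 0 := by
  have := S.prob
  have := S.noAtoms
  induction k using Nat.strong_induction_on with
  | _ k ih =>
  intro A₁ hA₁
  by_contra hpos
  have hpos1 : 0 < μ.real A₁ := lt_of_le_of_ne measureReal_nonneg (Ne.symm hpos)
  have hdisj : ∀ A ∈ fam n k, ∀ B ∈ fam n k, A ≠ B → μ (A ∩ B) = 0 := by
    intro A hA B hB hne
    rcases (A ∩ B).eq_empty_or_nonempty with h | h
    · rw [h]; simp
    · obtain ⟨k', hk', C, hC, hs⟩ := fam_inter hA hB hne h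
      exact measure_mono_null hs ((measureReal_eq_zero_iff).1 (ih k' hk' C hC))
  have hfin : {A : fam n k | μ A₁ ≤ μ (A : Set _)}.Finite := by
    apply Measure.finite_const_le_meas_of_disjoint_iUnion₀ μ
    · rw [pos_iff_ne_zero]
      intro h
      exact hpos ((measureReal_eq_zero_iff).2 h)
    · intro A
      exact (fam_closed A.2).measurableSet.nullMeasurableSet
    · intro A B hne
      exact hdisj A A.2 B B.2 (fun h => hne (Subtype.ext h))
    · finiteness
  -- maximise the measure
  obtain ⟨As, hAs, hmax⟩ := hfin.exists_maximalFor (fun A : fam n k => μ.real (A : Set _)) _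
    ⟨⟨A₁, hA₁⟩, le_refl (μ A₁)⟩
  have toE : ∀ A : fam n k, μ.real A₁ ≤ μ.real (A : Set _) → μ A₁ ≤ μ (A : Set _) :=
    fun A h => (ENNReal.toReal_le_toReal (by finiteness) (by finiteness)).1 h
  have hAs1 : μ.real A₁ ≤ μ.real (As : Set _) := ENNReal.toReal_mono (by finiteness) hAs
  have hM : ∀ A : fam n k, μ.real (A : Set _) ≤ μ.real (As : Set _) := by
    intro A
    by_contra! h
    have := hmax (j := A) (toE A (hAs1.trans h.le)) h.le
    exact absurd h (not_lt.2 this)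
  set M := μ.real (As : Set _) with hMdef
  have hstep : ∀ A : fam n k, μ.real (A : Set _) = M → ∀ i, μ.real (f i ⁻¹' (A : Set _)) = M := by
    intro A hA i
    apply S.avg_eq (b := fun i => μ.real (f i ⁻¹' (A : Set _)))
    · intro j
      exact hM ⟨_, S.fam_preimage j A.2⟩
    · rw [← hA]
      exact S.ss _ (fam_closed A.2).measurableSet
  have hfin2 : {A : fam n k | μ.real (A : Set _) = M}.Finite := by
    refine hfin.subset fun A hA => toE A ?_
    rw [mem_ofPred_eq] at hA
    rw [hA]; exact hAs1
  obtain ⟨B, hB, hBmax⟩ := hfin2.exists_maximalFor (fun A : fam n k => diam (A : Set (EuclideanSpace ℝ (Fin n)))) _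
    ⟨As, rfl⟩
  obtain ⟨i, hi⟩ := S.ex_min
  have hle : diam (f i ⁻¹' (B : Set (EuclideanSpace ℝ (Fin n)))) ≤
      diam (B : Set (EuclideanSpace ℝ (Fin n))) := by
    by_contra! h
    have := hBmax (j := ⟨_, S.fam_preimage i B.2⟩) (hstep B hB i) h.le
    exact absurd h (not_lt.2 this)
  have hle2 : diam (B : Set (EuclideanSpace ℝ (Fin n))) ≤ rr i * diam (f i ⁻¹' (B : Set _)) := by
    apply diam_le_of_forall_dist_le (mul_nonneg (S.pos i).le diam_nonneg)
    intro x hx y hy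
    obtain ⟨e, he⟩ := S.exists_affine i
    obtain ⟨x', rfl⟩ := e.surjective x
    obtain ⟨y', rfl⟩ := e.surjective y
    rw [he] at hx hy ⊢
    rw [he, S.sim]
    exact mul_le_mul_of_nonneg_left
      (dist_le_diam_of_mem (fam_bdd (S.fam_preimage i B.2)) hx hy) (S.pos i).le
  have h0 : diam (B : Set (EuclideanSpace ℝ (Fin n))) = 0 := by
    have h1 := S.pos i
    have h2 := (S.le_max i).trans_lt S.max_lt
    have h3 : 0 ≤ diam (B : Set (EuclideanSpace ℝ (Fin n))) := diam_nonneg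
    nlinarith
  have hsub : (B : Set (EuclideanSpace ℝ (Fin n))).Subsingleton := by
    intro x hx y hy
    have := dist_le_diam_of_mem (fam_bdd B.2) hx hy
    rw [h0] at this
    exact dist_le_zero.1 this
  have : μ.real (B : Set _) = 0 := (measureReal_eq_zero_iff).2 (hsub.measure_zero μ)
  rw [mem_ofPred_eq, this] at hB
  linarith

lemma sphere_null (S : Sys f rr E rmin rmax c s μ) (x : EuclideanSpace ℝ (Fin n)) (r : ℝ) :
    μ (sphere x r) = 0 := by
  have := S.prob
  rw [← measureReal_eq_zero_iff]
  exact S.fam_null _ _ ⟨⊤, x, r, rfl, by simp⟩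

lemma m_cont (S : Sys f rr E rmin rmax c s μ) :
    Continuous fun p : EuclideanSpace ℝ (Fin n) × ℝ => μ.real (closedBall p.1 p.2) := by
  have := S.prob
  rw [continuous_iff_continuousAt]
  rintro ⟨x, d⟩
  have h : Tendsto (fun p : EuclideanSpace ℝ (Fin n) × ℝ => μ (closedBall p.1 p.2)) (𝓝 (x, d))
      (𝓝 (μ (closedBall x d))) := by
    apply tendsto_measure_of_ae_tendsto_indicator_of_isFiniteMeasure
    · exact isClosed_closedBall.measurableSet
    · intro p; exact isClosed_closedBall.measurableSet
    · have h0 : ∀ᵐ y ∂μ, y ∉ sphere x d := by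
        rw [ae_iff]; simp only [not_not]; exact S.sphere_null x d
      filter_upwards [h0] with y hy
      have hc : Continuous fun p : EuclideanSpace ℝ (Fin n) × ℝ => dist y p.1 := by fun_prop
      have hc2 : Continuous fun p : EuclideanSpace ℝ (Fin n) × ℝ => p.2 := by fun_prop
      rcases lt_or_gt_of_ne (show dist y x ≠ d from hy) with h | h
      · filter_upwards [(isOpen_lt hc hc2).mem_nhds (show (x, d) ∈ _ from h)] with p hp
        simp only [mem_closedBall]
        exact ⟨fun _ => h.le, fun _ => le_of_lt hp⟩
      · filter_upwards [(isOpen_lt hc2 hc).mem_nhds (show (x, d) ∈ _ from h)] with p hp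
        simp only [mem_closedBall]
        exact ⟨fun h' => absurd h' (not_le.2 hp), fun h' => absurd h' (not_le.2 h)⟩
  exact (ENNReal.tendsto_toReal (measure_ne_top μ _)).comp h

lemma ball_eq (S : Sys f rr E rmin rmax c s μ) (x : EuclideanSpace ℝ (Fin n)) (r : ℝ) :
    μ.real (ball x r) = μ.real (closedBall x r) := by
  have := S.prob
  refine le_antisymm (measureReal_mono ball_subset_closedBall) ?_
  rw [← ball_union_sphere]
  refine (measureReal_union_le _ _).trans ?_
  rw [(measureReal_eq_zero_iff).2 (S.sphere_null x r), add_zero]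

lemma scale (S : Sys f rr E rmin rmax c s μ) (i : Fin N) {x} (hx : x ∈ E) {d : ℝ}
    (hd : rr i * d ≤ c) :
    μ.real (closedBall (f i x) (rr i * d)) = rr i ^ s * μ.real (closedBall x d) := by
  rw [← S.ball_eq, ← S.ball_eq, S.ss_one isOpen_ball.measurableSet i]
  · congr 2
    ext y
    simp only [mem_preimage, mem_ball, S.sim]
    exact mul_lt_mul_iff_right₀ (S.pos i)
  · intro j hj y hy h
    have := S.sep j i hj y hy x hx
    rw [mem_ball] at h
    linarith

lemma scale_ge (S : Sys f rr E rmin rmax c s μ) (i : Fin N) (x) (d : ℝ) :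
    rr i ^ s * μ.real (closedBall x d) ≤ μ.real (closedBall (f i x) (rr i * d)) := by
  have := S.prob
  rw [S.ss (closedBall (f i x) (rr i * d)) isClosed_closedBall.measurableSet]
  have h : f i ⁻¹' (closedBall (f i x) (rr i * d)) = closedBall x d := by
    ext y
    simp only [mem_preimage, mem_closedBall, S.sim]
    exact mul_le_mul_iff_right₀ (S.pos i)
  rw [← h]
  exact Finset.single_le_sum (f := fun j => rr j ^ s * μ.real (f j ⁻¹' (closedBall (f i x) (rr i * d))))
    (fun j _ => mul_nonneg (S.wpos j).le measureReal_nonneg) (Finset.mem_univ i)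

lemma m_pos_pow (S : Sys f rr E rmin rmax c s μ) (k : ℕ) :
    ∀ x ∈ E, 0 < μ.real (closedBall x (rmax ^ k)) := by
  have := S.prob
  induction k with
  | zero =>
    intro x hx
    refine lt_of_lt_of_le one_pos ?_
    rw [← S.real_E]
    apply S.mono_E
    intro y hy _
    rw [pow_zero]
    exact S.dle y hy x hx
  | succ k ih =>
    intro x hx
    obtain ⟨i, y, hy, rfl⟩ := (S.inv x).1 hx
    refine lt_of_lt_of_le (mul_pos (S.wpos i) (ih y hy)) ((S.scale_ge i y _).trans ?_)
    refine measureReal_mono (closedBall_subset_closedBall ?_) (by finiteness)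
    rw [pow_succ']
    exact mul_le_mul_of_nonneg_right (S.le_max i) (pow_pos S.max_pos k).le

lemma m_pos (S : Sys f rr E rmin rmax c s μ) {x} (hx : x ∈ E) {d : ℝ} (hd : 0 < d) :
    0 < μ.real (closedBall x d) := by
  have := S.prob
  obtain ⟨k, hk⟩ := exists_pow_lt_of_lt_one hd S.max_lt
  exact (S.m_pos_pow k x hx).trans_le
    (measureReal_mono (closedBall_subset_closedBall hk.le) (by finiteness))

/-- maximal pair -/
lemma exists_max (S : Sys f rr E rmin rmax c s μ) {a : ℝ} (ha : 0 < a) (hac : rmin * a ≤ c) :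
    ∃ P : ℝ, 0 < P ∧ ∃ x0 ∈ E, ∃ d0, a * rmin ≤ d0 ∧ d0 < a ∧
      (2 * d0) ^ s = P * μ.real (closedBall x0 d0) ∧
      ∀ x ∈ E, ∀ d, a * rmin ≤ d → d ≤ a → (2 * d) ^ s ≤ P * μ.real (closedBall x d) := by
  have hmin1 : rmin < 1 := by
    obtain ⟨i, hi⟩ := S.ex_min
    rw [← hi]; exact (S.le_max i).trans_lt S.max_lt
  have hlow : 0 < a * rmin := mul_pos ha S.min_pos
  have hK : IsCompact (E ×ˢ Icc (a * rmin) a) := S.cp.prod isCompact_Icc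
  have hne : (E ×ˢ Icc (a * rmin) a).Nonempty :=
    S.ne.prod ⟨a, by nlinarith, le_rfl⟩
  have hcont : ContinuousOn (fun p : EuclideanSpace ℝ (Fin n) × ℝ =>
      (2 * p.2) ^ s / μ.real (closedBall p.1 p.2)) (E ×ˢ Icc (a * rmin) a) := by
    apply ContinuousOn.div
    · apply Continuous.continuousOn
      exact (continuous_const.mul continuous_snd).rpow_const (fun _ => Or.inr S.spos.le)
    · exact S.m_cont.continuousOn
    · rintro ⟨x, d⟩ ⟨hx, hd⟩
      exact (S.m_pos hx (hlow.trans_le hd.1)).ne'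
  obtain ⟨⟨x1, d1⟩, ⟨hx1, hd1⟩, hmax⟩ := hK.exists_isMaxOn hne hcont
  simp only at hx1 hd1
  have hd1p : 0 < d1 := hlow.trans_le hd1.1
  have hm1 := S.m_pos hx1 hd1p
  refine ⟨(2 * d1) ^ s / μ.real (closedBall x1 d1), by positivity, ?_⟩
  have hall : ∀ x ∈ E, ∀ d, a * rmin ≤ d → d ≤ a → (2 * d) ^ s ≤
      (2 * d1) ^ s / μ.real (closedBall x1 d1) * μ.real (closedBall x d) := by
    intro x hx d h1 h2
    have := hmax (show (x, d) ∈ E ×ˢ Icc (a * rmin) a from ⟨hx, h1, h2⟩)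
    simp only [mem_ofPred_eq] at this
    rwa [div_le_iff₀ (S.m_pos hx (hlow.trans_le h1))] at this
  rcases hd1.2.lt_or_eq with hlt | heq
  · exact ⟨x1, hx1, d1, hd1.1, hlt, by field_simp, hall⟩
  · obtain ⟨i, hi⟩ := S.ex_min
    refine ⟨f i x1, S.mapE i hx1, a * rmin, le_rfl, by nlinarith, ?_, hall⟩
    have h := S.scale i hx1 (d := d1) (by rw [hi, heq]; exact hac)
    rw [show a * rmin = rr i * d1 by rw [hi, heq]; ring, h,
      show 2 * (rr i * d1) = rr i * (2 * d1) by ring,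
      Real.mul_rpow (S.pos i).le (by positivity)]
    field_simp

/-- the bound extends to all small radii -/
lemma bound_all (S : Sys f rr E rmin rmax c s μ) {a P : ℝ} (ha : 0 < a) (hac : rmin * a ≤ c)
    (h : ∀ x ∈ E, ∀ d, a * rmin ≤ d → d ≤ a → (2 * d) ^ s ≤ P * μ.real (closedBall x d)) :
    ∀ x ∈ E, ∀ d, 0 < d → d ≤ a → (2 * d) ^ s ≤ P * μ.real (closedBall x d) := by
  have key : ∀ k : ℕ, ∀ x ∈ E, ∀ d, 0 < d → a * rmin * rmax ^ k ≤ d → d ≤ a →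
      (2 * d) ^ s ≤ P * μ.real (closedBall x d) := by
    intro k
    induction k with
    | zero => intro x hx d _ h1 h2; exact h x hx d (by simpa using h1) h2
    | succ k ih =>
      intro x hx d hd h1 h2
      by_cases h3 : a * rmin ≤ d
      · exact h x hx d h3 h2
      push Not at h3
      obtain ⟨i, y, hy, rfl⟩ := (S.inv x).1 hx
      have hp := S.pos i
      have e : rr i * (d / rr i) = d := by field_simp
      have h4 := ih y hy (d / rr i) (div_pos hd hp)
        (by
          rw [le_div_iff₀ hp]
          refine le_trans ?_ h1
          rw [pow_succ, ← mul_assoc]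
          exact mul_le_mul_of_nonneg_left (S.le_max i)
            (by have := S.min_pos; have := S.max_pos; positivity))
        (by
          rw [div_le_iff₀ hp]
          exact h3.le.trans (mul_le_mul_of_nonneg_left (S.min_le i) ha.le))
      have h5 := S.scale i hy (d := d / rr i) (by rw [e]; linarith)
      rw [e] at h5
      rw [h5]
      have h6 : (2 * d) ^ s = rr i ^ s * (2 * (d / rr i)) ^ s := by
        rw [← Real.mul_rpow hp.le (by positivity)]
        congr 1; field_simp
      rw [h6]
      calc rr i ^ s * (2 * (d / rr i)) ^ s ≤ rr i ^ s * (P * μ.real (closedBall y (d / rr i))) :=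
            mul_le_mul_of_nonneg_left h4 (S.wpos i).le
        _ = _ := by ring
  intro x hx d hd hda
  obtain ⟨k, hk⟩ := exists_pow_lt_of_lt_one (show 0 < d / (a * rmin) from
    div_pos hd (mul_pos ha S.min_pos)) S.max_lt
  refine key k x hx d hd ?_ hda
  rw [lt_div_iff₀ (mul_pos ha S.min_pos)] at hk
  linarith

lemma boundary (S : Sys f rr E rmin rmax c s μ) {a P : ℝ}
    (h : ∀ x ∈ E, ∀ d, 0 < d → d ≤ a → (2 * d) ^ s ≤ P * μ.real (closedBall x d))
    {x0} (hx0 : x0 ∈ E) {d0 : ℝ} (hd0 : 0 < d0) (hda : d0 < a)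
    (he : (2 * d0) ^ s = P * μ.real (closedBall x0 d0)) :
    (sphere x0 d0 ∩ E).Nonempty := by
  by_contra hem
  rw [not_nonempty_iff_eq_empty] at hem
  -- the distances from x0 to points of E beyond d0 stay away from d0
  have : ∃ d1, d0 < d1 ∧ d1 ≤ a ∧ ∀ y ∈ E, dist y x0 ≤ d1 → dist y x0 ≤ d0 := by
    have hcl : IsCompact ((fun y => dist y x0) '' E) := S.cp.image (by fun_prop)
    have hd : d0 ∉ (fun y => dist y x0) '' E := by
      rintro ⟨y, hy, h⟩
      have : y ∈ sphere x0 d0 ∩ E := ⟨h, hy⟩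
      rw [hem] at this
      exact this
    obtain ⟨ε, hε, hb⟩ := Metric.isOpen_iff.1 hcl.isClosed.isOpen_compl d0 hd
    refine ⟨min a (d0 + ε / 2), lt_min hda (by linarith), min_le_left _ _, ?_⟩
    intro y hy hle
    by_contra! hlt
    have h1 : dist y x0 ∈ ball d0 ε := by
      rw [mem_ball, Real.dist_eq, abs_lt]
      have := hle.trans (min_le_right _ _)
      constructor <;> linarith
    exact hb h1 ⟨y, hy, rfl⟩
  obtain ⟨d1, h1, h2, h3⟩ := this
  have h4 := h x0 hx0 d1 (hd0.trans h1) h2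
  have h5 : μ.real (closedBall x0 d1) ≤ μ.real (closedBall x0 d0) :=
    S.mono_E fun y hy hE => h3 y hE hy
  have h6 : (2 * d0) ^ s < (2 * d1) ^ s :=
    Real.rpow_lt_rpow (by positivity) (by linarith) S.spos
  have hP : 0 < P := by
    have hm := S.m_pos hx0 hd0
    have : 0 < P * μ.real (closedBall x0 d0) := by rw [← he]; positivity
    exact pos_of_mul_pos_left this hm.le
  have := mul_le_mul_of_nonneg_left h5 hP.le
  linarith

/-- upper bound -/
lemma packM_le (S : Sys f rr E rmin rmax c s μ) [Nontrivial (EuclideanSpace ℝ (Fin n))]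
    {a P : ℝ} (ha : 0 < a) (hP : 0 < P)
    (h : ∀ x ∈ E, ∀ d, 0 < d → d ≤ a → (2 * d) ^ s ≤ P * μ.real (closedBall x d)) :
    packM s E ≤ ENNReal.ofReal P := by
  have := S.prob
  have h1 : packPre0 s E ≤ ENNReal.ofReal P := by
    refine (iInf₂_le a ha).trans ?_
    unfold packPre
    refine iSup_le fun cen => iSup_le fun rad => iSup_le fun hcen => iSup_le fun hdiam =>
      iSup_le fun hdisj => ?_
    calc ∑' i, ENNReal.ofReal (diam (closedBall (cen i) (rad i)) ^ s)
        ≤ ∑' i, ENNReal.ofReal P * μ (closedBall (cen i) (rad i)) := by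
          apply ENNReal.tsum_le_tsum
          intro i
          rcases le_or_gt (rad i) 0 with hr | hr
          · have : diam (closedBall (cen i) (rad i)) = 0 :=
              diam_subsingleton (subsingleton_closedBall _ hr)
            rw [this, Real.zero_rpow S.spos.ne']; simp
          · have hd := hdiam i
            rw [diam_closedBall_eq _ hr.le] at hd ⊢
            refine (ENNReal.ofReal_le_ofReal (h _ (hcen i) _ hr (by linarith))).trans ?_
            rw [ENNReal.ofReal_mul hP.le, ofReal_measureReal]
      _ = ENNReal.ofReal P * μ (⋃ i, closedBall (cen i) (rad i)) := by
          rw [ENNReal.tsum_mul_left, measure_iUnion hdisj fun i => isClosed_closedBall.measurableSet]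
      _ ≤ ENNReal.ofReal P * 1 := by gcongr; exact prob_le_one
      _ = _ := mul_one _
  have h0 : packPre0 s (∅ : Set (EuclideanSpace ℝ (Fin n))) = 0 := by
    refine le_antisymm ((iInf₂_le 1 one_pos).trans ?_) (by simp)
    unfold packPre
    refine iSup_le fun cen => iSup_le fun rad => iSup_le fun hcen => (hcen 0).elim
  refine (iInf₂_le (fun i : ℕ => if i = 0 then E else ∅) ?_).trans ?_
  · intro x hx
    exact mem_iUnion.2 ⟨0, by simpa using hx⟩
  · rw [tsum_eq_single 0]
    · simpa using h1
    · intro i hi; simp [hi, h0]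

/-- zero lemma: proper closed subsets which are backward invariant are null -/
lemma zero_of_proper (S : Sys f rr E rmin rmax c s μ) {Z : Set (EuclideanSpace ℝ (Fin n))}
    (hZ : IsClosed Z) (hinv : ∀ i, ∀ x ∈ E, f i x ∈ Z → x ∈ Z)
    {x} (hx : x ∈ E) (hxZ : x ∉ Z) : μ.real Z = 0 := by
  have key : ∀ k : ℕ, ∃ g : EuclideanSpace ℝ (Fin n) → EuclideanSpace ℝ (Fin n),
      Continuous g ∧ (∀ y z, dist (g y) (g z) ≤ rmax ^ k * dist y z) ∧ MapsTo g E E ∧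
      (∃ y ∈ E, g y = x) ∧ (∀ y ∈ E, g y ∈ Z → y ∈ Z) ∧ μ.real (g ⁻¹' Z) = μ.real Z := by
    intro k
    induction k with
    | zero => exact ⟨id, continuous_id, by simp, fun _ h => h, ⟨x, hx, rfl⟩, fun _ _ h => h, rfl⟩
    | succ k ih =>
      obtain ⟨g, hg, hl, hm, ⟨y, hy, hgy⟩, hb, he⟩ := ih
      obtain ⟨i, z, hz, rfl⟩ := (S.inv y).1 hy
      refine ⟨g ∘ f i, hg.comp (S.cont i), ?_, fun w hw => hm (S.mapE i hw), ⟨z, hz, hgy⟩,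
        fun w hw h => hinv i w hw (hb _ (S.mapE i hw) h), ?_⟩
      · intro u v
        refine (hl _ _).trans ?_
        rw [S.sim, pow_succ, mul_assoc]
        have := S.max_pos
        gcongr
        exact S.le_max i
      · have h1 := S.avg_eq (b := fun i => μ.real (f i ⁻¹' (g ⁻¹' Z))) (M := μ.real Z)
          (fun j => S.mono_E fun w hw hE => hinv j w hE (hb _ (S.mapE j hE) hw))
          (by rw [← he]; exact S.ss _ (hZ.preimage hg).measurableSet) i
        exact h1
  obtain ⟨ε, hε, hball⟩ := Metric.isOpen_iff.1 hZ.isOpen_compl x hxZ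
  obtain ⟨k, hk⟩ := exists_pow_lt_of_lt_one hε S.max_lt
  obtain ⟨g, hg, hl, hm, ⟨y, hy, hgy⟩, hb, he⟩ := key k
  rw [← he]
  apply S.real_zero
  intro z hz hzE
  refine hball (?_ : g z ∈ ball x ε) hz
  rw [mem_ball, ← hgy]
  have h1 := S.dle z hzE y hy
  have h2 := hl z y
  have h3 := pow_pos S.max_pos k
  nlinarith

/-- points at which all small scales are bad -/
def bad (μ : Measure (EuclideanSpace ℝ (Fin n))) (E : Set (EuclideanSpace ℝ (Fin n)))
    (s Q δ : ℝ) : Set (EuclideanSpace ℝ (Fin n)) :=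
  {x | x ∈ E ∧ ∀ d, 0 < d → d < δ → (2 * d) ^ s ≤ Q * μ.real (closedBall x d)}

lemma bad_closed_aux (S : Sys f rr E rmin rmax c s μ) (Q d : ℝ) :
    IsClosed {x : EuclideanSpace ℝ (Fin n) | (2 * d) ^ s ≤ Q * μ.real (closedBall x d)} := by
  have h1 : Continuous fun x : EuclideanSpace ℝ (Fin n) => (x, d) :=
    continuous_id.prodMk continuous_const
  have h2 : Continuous fun x : EuclideanSpace ℝ (Fin n) => μ.real (closedBall x d) :=
    Continuous.comp (g := fun p : EuclideanSpace ℝ (Fin n) × ℝ => μ.real (closedBall p.1 p.2))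
      (f := fun x : EuclideanSpace ℝ (Fin n) => (x, d)) S.m_cont h1
  have h3 : Continuous fun x : EuclideanSpace ℝ (Fin n) => Q * μ.real (closedBall x d) :=
    continuous_const.mul h2
  have h4 : Continuous fun _ : EuclideanSpace ℝ (Fin n) => (2 * d) ^ s := continuous_const
  exact isClosed_le h4 h3

lemma bad_closed (S : Sys f rr E rmin rmax c s μ) (Q δ : ℝ) : IsClosed (bad μ E s Q δ) := by
  have : bad μ E s Q δ = E ∩ ⋂ d : Ioo (0 : ℝ) δ,
      {x | (2 * (d : ℝ)) ^ s ≤ Q * μ.real (closedBall x (d : ℝ))} := by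
    ext x
    constructor
    · intro h
      exact ⟨h.1, mem_iInter.2 fun d => h.2 d d.2.1 d.2.2⟩
    · intro h
      exact ⟨h.1, fun d h1 h2 => mem_iInter.1 h.2 ⟨d, h1, h2⟩⟩
  rw [this]
  exact S.cp.isClosed.inter (isClosed_iInter fun d => S.bad_closed_aux Q d)

lemma bad_step (S : Sys f rr E rmin rmax c s μ) {Q δ δ' : ℝ} (hδ : δ ≤ c) (hδ' : rmax * δ ≤ δ')
    (i : Fin N) {x} (hx : x ∈ E)
    (h : f i x ∈ bad μ E s Q δ') : x ∈ bad μ E s Q δ := by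
  refine ⟨hx, fun d hd hdδ => ?_⟩
  have hp := S.pos i
  have hlt : rr i * d < rmax * δ := by
    have h1 := S.le_max i
    have h2 := S.max_pos
    nlinarith
  have h1 := h.2 (rr i * d) (by positivity) (hlt.trans_le hδ')
  have h3 : rr i * d ≤ c := by
    have := S.max_lt
    have h4 : rmax * δ ≤ δ := by nlinarith
    linarith
  rw [S.scale i hx h3, show 2 * (rr i * d) = rr i * (2 * d) by ring,
    Real.mul_rpow hp.le (by positivity),
    show Q * (rr i ^ s * μ.real (closedBall x d)) = rr i ^ s * (Q * μ.real (closedBall x d)) by ring]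
    at h1
  exact le_of_mul_le_mul_left h1 (S.wpos i)

lemma bad_null (S : Sys f rr E rmin rmax c s μ) {Q : ℝ} {x} (hx : x ∈ E) {d : ℝ} (hd : 0 < d)
    (hdc : d < c) (hQ : Q * μ.real (closedBall x d) < (2 * d) ^ s) {δ : ℝ} (hδ : 0 < δ) :
    μ (bad μ E s Q δ) = 0 := by
  have := S.prob
  have h0 : μ.real (bad μ E s Q c) = 0 := by
    refine S.zero_of_proper (S.bad_closed Q c) (fun i y hy h => ?_) hx
      (fun h => absurd (h.2 d hd hdc) (not_le.2 hQ))
    exact S.bad_step le_rfl (by have := S.max_lt; have := S.cpos; nlinarith) i hy h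
  have hk : ∀ k : ℕ, μ.real (bad μ E s Q (rmax ^ k * c)) = 0 := by
    intro k
    induction k with
    | zero => simpa using h0
    | succ k ih =>
      refine le_antisymm ?_ measureReal_nonneg
      rw [S.ss _ (S.bad_closed Q _).measurableSet, ← ih]
      apply S.avg_le
      intro i
      apply S.mono_E
      intro y hy hE
      refine S.bad_step ?_ ?_ i hE hy
      · have := pow_le_one₀ S.max_pos.le S.max_lt.le (n := k)
        have := S.cpos
        nlinarith
      · rw [pow_succ', mul_assoc]
  obtain ⟨k, hk1⟩ := exists_pow_lt_of_lt_one (div_pos hδ S.cpos) S.max_lt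
  rw [lt_div_iff₀ S.cpos] at hk1
  refine measure_mono_null ?_ ((measureReal_eq_zero_iff).1 (hk k))
  exact fun y hy => ⟨hy.1, fun e he1 he2 => hy.2 e he1 (he2.trans hk1)⟩

/-- good points -/
def good (μ : Measure (EuclideanSpace ℝ (Fin n))) (E : Set (EuclideanSpace ℝ (Fin n)))
    (s Q : ℝ) : Set (EuclideanSpace ℝ (Fin n)) :=
  {x | x ∈ E ∧ ∀ δ > 0, ∃ d, 0 < d ∧ d < δ ∧ Q * μ.real (closedBall x d) ≤ (2 * d) ^ s}

lemma good_full (S : Sys f rr E rmin rmax c s μ) {Q : ℝ} {x} (hx : x ∈ E) {d : ℝ} (hd : 0 < d)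
    (hdc : d < c) (hQ : Q * μ.real (closedBall x d) < (2 * d) ^ s) :
    1 ≤ μ (good μ E s Q) := by
  have := S.prob
  have hnull : μ (⋃ k : ℕ, bad μ E s Q (1 / ((k : ℝ) + 1))) = 0 := by
    rw [measure_iUnion_null_iff]
    intro k
    exact S.bad_null hx hd hdc hQ (by positivity)
  have hsub : E ⊆ good μ E s Q ∪ ⋃ k : ℕ, bad μ E s Q (1 / ((k : ℝ) + 1)) := by
    intro y hy
    by_cases h : y ∈ good μ E s Q
    · exact Or.inl h
    · right
      simp only [good, mem_ofPred_eq, hy, true_and] at h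
      push Not at h
      obtain ⟨δ, hδ, h⟩ := h
      obtain ⟨k, hk⟩ := exists_nat_one_div_lt hδ
      exact mem_iUnion.2 ⟨k, hy, fun e he1 he2 => (h e he1 (he2.trans hk)).le⟩
  have hE : μ E = 1 := by
    have := S.real_E
    rw [Measure.real] at this
    rw [← ENNReal.ofReal_toReal (measure_ne_top μ E), this, ENNReal.ofReal_one]
  calc 1 = μ E := hE.symm
    _ ≤ _ := measure_mono hsub
    _ ≤ _ := measure_union_le _ _
    _ = _ := by rw [hnull, add_zero]

lemma packPre_ge (S : Sys f rr E rmin rmax c s μ) [Nontrivial (EuclideanSpace ℝ (Fin n))]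
    {Q δ : ℝ} (hQ : 0 < Q) (hδ : 0 < δ) (A : Set (EuclideanSpace ℝ (Fin n))) :
    ENNReal.ofReal Q * μ (A ∩ good μ E s Q) ≤ packPre s δ A := by
  have := S.prob
  rcases (A ∩ good μ E s Q).eq_empty_or_nonempty with hem | ⟨z, hz⟩
  · rw [hem]; simp
  obtain ⟨t, r, htc, hts, hr, hcov, hdisj⟩ := Besicovitch.exists_disjoint_closedBall_covering_ae μ
    (fun x => {d | Q * μ.real (closedBall x d) ≤ (2 * d) ^ s}) (A ∩ good μ E s Q)
    (by
      intro x hx η hη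
      obtain ⟨d, h1, h2, h3⟩ := hx.2.2 η hη
      exact ⟨d, h3, h1, h2⟩)
    (fun _ => δ / 2) (fun _ _ => by positivity)
  have := htc.to_subtype
  obtain ⟨e, he⟩ := exists_injective_nat t
  classical
  let cen : ℕ → EuclideanSpace ℝ (Fin n) := fun k =>
    if h : ∃ x : t, e x = k then (h.choose : EuclideanSpace ℝ (Fin n)) else z
  let rad : ℕ → ℝ := fun k =>
    if h : ∃ x : t, e x = k then r (h.choose : EuclideanSpace ℝ (Fin n)) else -1
  have hce : ∀ x : t, cen (e x) = x := by
    intro x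
    have h : ∃ y : t, e y = e x := ⟨x, rfl⟩
    simp only [cen, dif_pos h]
    rw [he h.choose_spec]
  have hre : ∀ x : t, rad (e x) = r x := by
    intro x
    have h : ∃ y : t, e y = e x := ⟨x, rfl⟩
    simp only [rad, dif_pos h]
    rw [he h.choose_spec]
  have hout : ∀ k, (¬ ∃ x : t, e x = k) → cen k = z ∧ rad k = -1 := by
    intro k h
    simp only [cen, rad, dif_neg h, and_self]
  have hempty : closedBall z (-1 : ℝ) = ∅ := closedBall_eq_empty.2 (by norm_num)
  have hsum : ∑' k, ENNReal.ofReal (diam (closedBall (cen k) (rad k)) ^ s) ≤ packPre s δ A := by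
    unfold packPre
    refine le_iSup_of_le cen (le_iSup_of_le rad (le_iSup_of_le ?_ (le_iSup_of_le ?_
      (le_iSup_of_le ?_ le_rfl))))
    · intro k
      by_cases h : ∃ x : t, e x = k
      · obtain ⟨x, rfl⟩ := h
        rw [hce]; exact (hts x.2).1
      · rw [(hout k h).1]; exact hz.1
    · intro k
      by_cases h : ∃ x : t, e x = k
      · obtain ⟨x, rfl⟩ := h
        have h1 := (hr x x.2).2
        rw [hce, hre, diam_closedBall_eq _ h1.1.le]
        linarith [h1.2]
      · rw [(hout k h).1, (hout k h).2, hempty, diam_empty]; exact hδ.le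
    · intro k l hkl
      by_cases h : ∃ x : t, e x = k
      · by_cases h' : ∃ x : t, e x = l
        · obtain ⟨x, rfl⟩ := h
          obtain ⟨y, rfl⟩ := h'
          rw [hce, hre, hce, hre]
          exact hdisj x.2 y.2 (fun hxy => hkl (by rw [Subtype.ext hxy]))
        · rw [(hout l h').1, (hout l h').2, hempty]; exact disjoint_empty _
      · rw [(hout k h).1, (hout k h).2, hempty]; exact empty_disjoint _
  refine le_trans ?_ hsum
  refine le_trans ?_ (ENNReal.tsum_comp_le_tsum_of_injective he _)
  calc ENNReal.ofReal Q * μ (A ∩ good μ E s Q)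
      ≤ ENNReal.ofReal Q * μ (⋃ x ∈ t, closedBall x (r x)) := by
        gcongr 1
        refine (measure_mono (t := (⋃ x ∈ t, closedBall x (r x)) ∪
          ((A ∩ good μ E s Q) \ ⋃ x ∈ t, closedBall x (r x))) ?_).trans ?_
        · intro y hy
          by_cases h : y ∈ ⋃ x ∈ t, closedBall x (r x)
          · exact Or.inl h
          · exact Or.inr ⟨hy, h⟩
        · refine (measure_union_le _ _).trans ?_
          rw [hcov, add_zero]
    _ ≤ ENNReal.ofReal Q * ∑' x : t, μ (closedBall (x : EuclideanSpace ℝ (Fin n)) (r x)) := by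
        gcongr 1
        exact measure_biUnion_le μ htc _
    _ = ∑' x : t, ENNReal.ofReal Q * μ (closedBall (x : EuclideanSpace ℝ (Fin n)) (r x)) := by
        rw [ENNReal.tsum_mul_left]
    _ ≤ _ := by
        apply ENNReal.tsum_le_tsum
        intro x
        have h1 := hr x x.2
        rw [hce, hre, diam_closedBall_eq _ h1.2.1.le, ← ofReal_measureReal (μ := μ),
          ← ENNReal.ofReal_mul hQ.le]
        exact ENNReal.ofReal_le_ofReal h1.1

lemma packM_ge (S : Sys f rr E rmin rmax c s μ) [Nontrivial (EuclideanSpace ℝ (Fin n))]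
    {Q : ℝ} (hQ0 : 0 < Q) {x} (hx : x ∈ E) {d : ℝ} (hd : 0 < d)
    (hdc : d < c) (hQ : Q * μ.real (closedBall x d) < (2 * d) ^ s) :
    ENNReal.ofReal Q ≤ packM s E := by
  have := S.prob
  refine le_iInf₂ fun U hU => ?_
  calc ENNReal.ofReal Q = ENNReal.ofReal Q * 1 := (mul_one _).symm
    _ ≤ ENNReal.ofReal Q * μ (good μ E s Q) := by gcongr; exact S.good_full hx hd hdc hQ
    _ ≤ ENNReal.ofReal Q * μ (⋃ i, U i ∩ good μ E s Q) := by
        gcongr 2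
        intro y hy
        obtain ⟨i, hi⟩ := mem_iUnion.1 (hU hy.1)
        exact mem_iUnion.2 ⟨i, hi, hy⟩
    _ ≤ ENNReal.ofReal Q * ∑' i, μ (U i ∩ good μ E s Q) := by
        gcongr 1
        exact measure_iUnion_le _
    _ = ∑' i, ENNReal.ofReal Q * μ (U i ∩ good μ E s Q) := by rw [ENNReal.tsum_mul_left]
    _ ≤ _ := ENNReal.tsum_le_tsum fun i => le_iInf₂ fun δ hδ => S.packPre_ge hQ0 hδ (U i)

lemma main (S : Sys f rr E rmin rmax c s μ) [Nontrivial (EuclideanSpace ℝ (Fin n))]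
    {a : ℝ} (ha : 0 < a) (hac : rmin * a ≤ c) :
    ∃ x0 ∈ E, ∃ d0 : ℝ, a * rmin ≤ d0 ∧ d0 < a ∧
      packM s E = densityh μ s x0 d0 ∧ (sphere x0 d0 ∩ E).Nonempty := by
  have := S.prob
  obtain ⟨P, hP, x0, hx0, d0, h1, h2, he, hall⟩ := S.exists_max ha hac
  have hb := S.bound_all ha hac hall
  have hd0 : 0 < d0 := (mul_pos ha S.min_pos).trans_le h1
  have hm := S.m_pos hx0 hd0
  refine ⟨x0, hx0, d0, h1, h2, ?_, S.boundary hb hx0 hd0 h2 he⟩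
  have hden : densityh μ s x0 d0 = ENNReal.ofReal P := by
    unfold densityh
    rw [he, ← ofReal_measureReal (μ := μ), ← ENNReal.ofReal_div_of_pos hm]
    congr 1
    field_simp
  rw [hden]
  refine le_antisymm (S.packM_le ha hP hb) ?_
  have hlow : ∀ Q, 0 < Q → Q < P → ENNReal.ofReal Q ≤ packM s E := by
    intro Q hQ0 hQP
    obtain ⟨i, hi⟩ := S.ex_min
    have hlt : rr i * d0 < c := by
      rw [hi]; have := S.min_pos; nlinarith
    refine S.packM_ge hQ0 (S.mapE i hx0) (mul_pos (S.pos i) hd0) hlt ?_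
    rw [S.scale i hx0 hlt.le, show 2 * (rr i * d0) = rr i * (2 * d0) by ring,
      Real.mul_rpow (S.pos i).le (by positivity), he]
    have hw := S.wpos i
    have : Q * μ.real (closedBall x0 d0) < P * μ.real (closedBall x0 d0) :=
      mul_lt_mul_of_pos_right hQP hm
    nlinarith
  have ht : Tendsto (fun Q => ENNReal.ofReal Q) (𝓝[<] P) (𝓝 (ENNReal.ofReal P)) :=
    ENNReal.continuous_ofReal.continuousAt.tendsto.mono_left nhdsWithin_le_nhds
  refine le_of_tendsto ht ?_
  filter_upwards [Ioo_mem_nhdsLT hP] with Q hQ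
  exact hlow Q hQ.1 hQ.2

end Sys

end PackAux

theorem exists_optimal_ball_with_boundary_point
{n N : ℕ} (hN : 2 ≤ N)
    (f : Fin N → EuclideanSpace ℝ (Fin n) → EuclideanSpace ℝ (Fin n))
    (rr : Fin N → ℝ) (hr : ∀ i, 0 < rr i ∧ rr i < 1)
    (hsim : ∀ i x y, dist (f i x) (f i y) = rr i * dist x y)
    (E : Set (EuclideanSpace ℝ (Fin n))) (hEne : E.Nonempty) (hEcp : IsCompact E)
    (hEinv : E = ⋃ i, f i '' E)
    (hssc : ∀ i j, i ≠ j → Disjoint (f i '' E) (f j '' E))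
(hEdiam : Metric.diam E = 1)
(rmin : ℝ) (hrmin : IsLeast (Set.range rr) rmin)
(c : ℝ) (hc : 0 < c)
    (hcdef : c = sInf {d : ℝ | ∃ i j : Fin N, i ≠ j ∧
      ∃ u ∈ f i '' E, ∃ v ∈ f j '' E, d = dist u v})
(s : ℝ) (hs : 0 < s) (hsum : ∑ i, rr i ^ s = 1)
    (μ : MeasureTheory.Measure (EuclideanSpace ℝ (Fin n))) (hμ : IsProbabilityMeasure μ)
    (hμss : ∀ A : Set (EuclideanSpace ℝ (Fin n)), MeasurableSet A →
      μ A = ∑ i, ENNReal.ofReal (rr i ^ s) * μ (f i ⁻¹' A))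
    (a : ℝ) (ha : 0 < a) (ha' : a ≤ c / rmin) :
    ∃ x0 ∈ E, ∃ d0 : ℝ, a * rmin ≤ d0 ∧ d0 < a ∧
      packM s E = densityh μ s x0 d0 ∧
      (Metric.sphere x0 d0 ∩ E).Nonempty ∧
      ∃ y ∈ E, d0 = dist x0 y ∧
        packM s E = ENNReal.ofReal ((2 * dist x0 y) ^ s) /
          μ (Metric.closedBall x0 (dist x0 y)) := by
  obtain ⟨⟨i0, hi0⟩, hmin⟩ := hrmin
  have hmin' : ∀ i, rmin ≤ rr i := fun i => hmin ⟨i, rfl⟩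
  have hminpos : 0 < rmin := hi0 ▸ (hr i0).1
  have hne : (Finset.univ : Finset (Fin N)).Nonempty := ⟨i0, Finset.mem_univ _⟩
  obtain ⟨im, -, him⟩ := Finset.exists_max_image Finset.univ rr hne
  have S : PackAux.Sys f rr E rmin (rr im) c s μ :=
    { pos := fun i => (hr i).1
      sim := hsim
      ne := hEne
      cp := hEcp
      inv := by
        intro x
        conv_lhs => rw [hEinv]
        simp
      dle := by
        intro x hx y hy
        rw [← hEdiam]
        exact dist_le_diam_of_mem hEcp.isBounded hx hy
      min_le := hmin'
      min_pos := hminpos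
      ex_min := ⟨i0, hi0⟩
      le_max := fun i => him i (Finset.mem_univ _)
      max_pos := (hr im).1
      max_lt := (hr im).2
      cpos := hc
      sep := by
        intro i j hij x hx y hy
        rw [hcdef]
        apply csInf_le
        · refine ⟨0, ?_⟩
          rintro d ⟨_, _, _, u, _, v, _, rfl⟩
          exact dist_nonneg
        · exact ⟨i, j, hij, _, ⟨x, hx, rfl⟩, _, ⟨y, hy, rfl⟩, rfl⟩
      spos := hs
      sum := hsum
      prob := hμ
      ss := by
        intro A hA
        rw [Measure.real, hμss A hA, ENNReal.toReal_sum]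
        · refine Finset.sum_congr rfl fun i _ => ?_
          rw [ENNReal.toReal_mul, ENNReal.toReal_ofReal (Real.rpow_nonneg (hr i).1.le s), Measure.real]
        · intro i _
          finiteness }
  have hnt : Nontrivial (EuclideanSpace ℝ (Fin n)) := by
    by_contra h
    rw [not_nontrivial_iff_subsingleton] at h
    rw [diam_subsingleton subsingleton_of_subsingleton] at hEdiam
    exact zero_ne_one hEdiam
  have hac : rmin * a ≤ c := by
    rw [le_div_iff₀ hminpos] at ha'
    linarith
  obtain ⟨x0, hx0, d0, h1, h2, h3, y, hy, hyE⟩ := S.main ha hac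
  have hd : d0 = dist x0 y := by rw [dist_comm]; exact (mem_sphere.1 hy).symm
  refine ⟨x0, hx0, d0, h1, h2, h3, ⟨y, hy, hyE⟩, y, hyE, hd, ?_⟩
  rw [← hd]
  exact h3
end
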